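/- arXiv:1307.2481 — 2 statements merged into one kernel-verified Lean document; each statement's English description precedes it below -/
import Mathlib

section
/- Let k ≥ 2 be an integer and let ε > 0. Then there exists a constant C = C(k,ε) > 0 such that for all real Z ≥ 1 one has |A_k(Z) − c_k·Z| ≤ C·Z^{14/(9k)+ε}. -/
/-- A positive integer is `k`-free if it is divisible by `p^k` for no prime `p`. -/
def KFree (k n : ℕ) : Prop := ∀ p : ℕ, p.Prime → ¬ p ^ k ∣ n

/-- `Acount k Z` is the number of positive integers `n ≤ Z` such that both `n` and
`n+1` are `k`-free. -/
noncomputable def Acount (k : ℕ) (Z : ℝ) : ℕ :=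
  {n : ℕ | 0 < n ∧ (n : ℝ) ≤ Z ∧ KFree k n ∧ KFree k (n + 1)}.ncard

/-- `ck k` is the infinite product `∏_p (1 - 2/p^k)` over all primes `p`. -/
noncomputable def ck (k : ℕ) : ℝ := ∏' p : Nat.Primes, (1 - 2 / (p : ℝ) ^ k)

/-- The divided difference, over the nodes `x i` with `i ∈ s`, of the values `f i`. -/
noncomputable def dividedDiff {ι : Type*} [DecidableEq ι] (s : Finset ι) (x f : ι → ℝ) : ℝ :=
  ∑ i ∈ s, Lagrange.nodalWeight s x i * f i

section DividedDiff

variable {ι : Type*} [DecidableEq ι] {s : Finset ι} {x : ι → ℝ}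

lemma nodalWeight_eq_mul_erase {r i : ι} (hr : r ∈ s) (hri : i ≠ r) :
    Lagrange.nodalWeight s x i = (x i - x r)⁻¹ * Lagrange.nodalWeight (s.erase r) x i := by
  unfold Lagrange.nodalWeight
  rw [Finset.erase_right_comm, Finset.mul_prod_erase (s.erase i) (fun j => (x i - x j)⁻¹)
    (Finset.mem_erase.2 ⟨hri.symm, hr⟩)]

lemma dividedDiff_sub_mul (hx : Set.InjOn x s) {r : ι} (hr : r ∈ s) (f : ι → ℝ) :
    dividedDiff s x (fun i => (x i - x r) * f i) = dividedDiff (s.erase r) x f := by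
  unfold dividedDiff
  rw [← Finset.add_sum_erase s _ hr]
  simp only [sub_self, zero_mul, mul_zero, zero_add]
  refine Finset.sum_congr rfl fun i hi => ?_
  obtain ⟨hir, his⟩ := Finset.mem_erase.1 hi
  have hne : x i - x r ≠ 0 := sub_ne_zero.2 fun h => hir (hx his hr h)
  rw [nodalWeight_eq_mul_erase hr hir]
  field_simp

lemma dividedDiff_add (f g : ι → ℝ) :
    dividedDiff s x (fun i => f i + g i) = dividedDiff s x f + dividedDiff s x g := by
  simp [dividedDiff, mul_add, Finset.sum_add_distrib]

lemma dividedDiff_const_mul (c : ℝ) (f : ι → ℝ) :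
    dividedDiff s x (fun i => c * f i) = c * dividedDiff s x f := by
  simp only [dividedDiff, Finset.mul_sum]
  exact Finset.sum_congr rfl fun i _ => by ring

lemma dividedDiff_one (n : ℕ) (hx : Set.InjOn x s) (hs : s.card = n + 1) :
    dividedDiff s x (fun _ => 1) = if n = 0 then 1 else 0 := by
  induction n generalizing s with
  | zero =>
    obtain ⟨a, rfl⟩ := Finset.card_eq_one.1 (by simpa using hs)
    simp [dividedDiff, Lagrange.nodalWeight]
  | succ n ih =>
    obtain ⟨a, ha, b, hb, hab⟩ := Finset.one_lt_card.1 (by omega : 1 < s.card)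
    have hne : x b - x a ≠ 0 := sub_ne_zero.2 fun h => hab (hx ha hb h.symm)
    have key : ∀ r ∈ s, dividedDiff s x (fun i => x i - x r) = if n = 0 then 1 else 0 := by
      intro r hr
      have h := dividedDiff_sub_mul hx hr (fun _ => 1)
      simp only [mul_one] at h
      rw [h]
      exact ih (hx.mono (by simp)) (by rw [Finset.card_erase_of_mem hr]; omega)
    have h : dividedDiff s x (fun i => x i - x a)
        = dividedDiff s x (fun i => x i - x b) + (x b - x a) * dividedDiff s x (fun _ => 1) := by
      rw [← dividedDiff_const_mul, ← dividedDiff_add]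
      congr 1
      ext i
      ring
    rw [key a ha, key b hb] at h
    have : dividedDiff s x (fun _ => 1) = 0 := by
      rcases mul_eq_zero.1 (by linarith : (x b - x a) * dividedDiff s x (fun _ => 1) = 0) with h | h
      · exact absurd h hne
      · exact h
    simp [this]

lemma dividedDiff_pow_succ (hx : Set.InjOn x s) {r : ι} (hr : r ∈ s) (a : ℕ) :
    dividedDiff s x (fun i => x i ^ (a + 1))
      = x r * dividedDiff s x (fun i => x i ^ a)
        + dividedDiff (s.erase r) x (fun i => x i ^ a) := by
  rw [← dividedDiff_sub_mul hx hr, ← dividedDiff_const_mul, ← dividedDiff_add]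
  congr 1
  ext i
  ring

end DividedDiff

/-- The divided differences of a monomial are close to its Taylor coefficients. -/
lemma exists_abs_dividedDiff_pow_sub_le (a : ℕ) :
    ∃ C : ℝ, 0 ≤ C ∧ ∀ {ι : Type} [DecidableEq ι] (s : Finset ι) (x : ι → ℝ) (n : ℕ) (y L : ℝ),
      Set.InjOn x s → s.card = n + 1 → |y| ≤ 2 → L ≤ 1 → (∀ i ∈ s, |x i - y| ≤ L) →
      |dividedDiff s x (fun i => x i ^ a) - a.choose n * y ^ (a - n)| ≤ C * L := by
  induction a with
  | zero =>
    refine ⟨0, le_rfl, fun s x n y L hx hs _ _ _ => ?_⟩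
    simp only [pow_zero, dividedDiff_one n hx hs]
    rcases n with _ | n <;> simp
  | succ a ih =>
    obtain ⟨C, hC, h⟩ := ih
    refine ⟨4 * C + 4 ^ a, by positivity, fun {ι} _ s x n y L hx hs hy hL hxy => ?_⟩
    obtain ⟨r, hr⟩ : s.Nonempty := Finset.card_pos.1 (by omega)
    rw [dividedDiff_pow_succ hx hr]
    have hL0 : 0 ≤ L := (abs_nonneg _).trans (hxy r hr)
    have hxr : |x r| ≤ 3 := by
      have := abs_add_le (x r - y) y
      rw [sub_add_cancel] at this
      linarith [hxy r hr]
    have h1 := h s x n y L hx hs hy hL hxy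
    have hcb : |(a.choose n : ℝ) * y ^ (a - n)| ≤ 4 ^ a := by
      rw [abs_mul, abs_pow, Nat.abs_cast]
      have e1 : (a.choose n : ℝ) ≤ 2 ^ a := by exact_mod_cast Nat.choose_le_two_pow a n
      have e2 : |y| ^ (a - n) ≤ 2 ^ a :=
        (pow_le_pow_left₀ (abs_nonneg _) hy _).trans
          (pow_le_pow_right₀ (by norm_num) (Nat.sub_le _ _))
      calc _ ≤ (2 : ℝ) ^ a * 2 ^ a := by gcongr
        _ = 4 ^ a := by rw [← mul_pow]; norm_num
    have h2 : |x r * dividedDiff s x (fun i => x i ^ a) - y * (a.choose n * y ^ (a - n))|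
        ≤ 3 * (C * L) + L * 4 ^ a := by
      have e : x r * dividedDiff s x (fun i => x i ^ a) - y * (a.choose n * y ^ (a - n))
          = x r * (dividedDiff s x (fun i => x i ^ a) - a.choose n * y ^ (a - n))
            + (x r - y) * (a.choose n * y ^ (a - n)) := by ring
      rw [e]
      refine (abs_add_le _ _).trans ?_
      rw [abs_mul, abs_mul]
      have := hxy r hr
      gcongr
    have h3 : y * ((a.choose n : ℝ) * y ^ (a - n)) = a.choose n * y ^ (a + 1 - n) := by
      rcases le_or_gt n a with hna | hna
      · rw [Nat.sub_add_comm hna, pow_succ]; ring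
      · simp [Nat.choose_eq_zero_of_lt hna]
    rw [h3] at h2
    rcases n with _ | n
    · have : s.erase r = ∅ := Finset.card_eq_zero.1 (by rw [Finset.card_erase_of_mem hr]; omega)
      rw [this]
      simp only [dividedDiff, Finset.sum_empty, add_zero, Nat.choose_zero_right] at h2 ⊢
      refine h2.trans ?_
      nlinarith [mul_nonneg hC hL0]
    · have h4 := h (s.erase r) x n y L (hx.mono (by simp))
        (by rw [Finset.card_erase_of_mem hr]; omega) hy hL
        (fun i hi => hxy i (Finset.mem_of_mem_erase hi))
      rw [Nat.choose_succ_succ, Nat.add_sub_add_right]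
      rw [Nat.add_sub_add_right] at h2
      push_cast
      have := abs_add_le
        (x r * dividedDiff s x (fun i => x i ^ a) - a.choose (n + 1) * y ^ (a - n))
        (dividedDiff (s.erase r) x (fun i => x i ^ a) - a.choose n * y ^ (a - n))
      calc _ = _ := by congr 1; ring
        _ ≤ _ := this
        _ ≤ _ := add_le_add h2 h4
        _ = _ := by ring

/-- The Taylor coefficients at `y` of the monomials `X ^ a j`. -/
def taylorMatrix {N : ℕ} (a : Fin N → ℕ) (y : ℝ) (i j : Fin N) : ℝ :=
  (a j).choose i * y ^ (a j - i)

lemma det_choose_ne_zero {N : ℕ} {a : Fin N → ℕ} (ha : Function.Injective a) :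
    (Matrix.of fun i j : Fin N => ((a i).choose j : ℝ)).det ≠ 0 := by
  have h := Matrix.det_eval_matrixOfPolynomials_eq_det_vandermonde (fun i => (a i : ℝ))
    (fun i => descPochhammer ℝ i) (fun i => descPochhammer_natDegree ℝ i)
    (fun i => monic_descPochhammer ℝ i)
  have h1 : (Matrix.of fun i j : Fin N => (descPochhammer ℝ j).eval (a i : ℝ))
      = Matrix.of fun i j : Fin N => ((j : ℕ).factorial : ℝ) *
        (Matrix.of fun i j : Fin N => ((a i).choose j : ℝ)) i j := by
    ext i j
    simp only [Matrix.of_apply]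
    rw [descPochhammer_eval_eq_descFactorial, Nat.descFactorial_eq_factorial_mul_choose]
    push_cast
    rfl
  rw [h1, Matrix.det_mul_row] at h
  intro h0
  rw [h0, mul_zero] at h
  exact Matrix.det_vandermonde_ne_zero_iff.2 (fun i j hij => ha (by simpa using hij)) h

lemma det_taylorMatrix_ne_zero {N : ℕ} {a : Fin N → ℕ} (ha : Function.Injective a) {y : ℝ}
    (hy : y ≠ 0) : (Matrix.of (taylorMatrix a y)).det ≠ 0 := by
  have h : Matrix.of (fun i j : Fin N => y ^ (i : ℕ) * (Matrix.of (taylorMatrix a y)) i j)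
      = Matrix.of fun i j : Fin N => y ^ a j *
        (Matrix.of fun i j : Fin N => ((a i).choose j : ℝ)).transpose i j := by
    ext i j
    simp only [Matrix.of_apply, Matrix.transpose_apply, taylorMatrix]
    rcases le_or_gt (i : ℕ) (a j) with hij | hij
    · rw [mul_left_comm, ← pow_add, Nat.add_sub_cancel' hij, mul_comm]
    · simp [Nat.choose_eq_zero_of_lt hij]
  have h' := congrArg Matrix.det h
  rw [Matrix.det_mul_column, Matrix.det_mul_row, Matrix.det_transpose] at h'
  intro h0
  rw [h0, mul_zero] at h'
  exact mul_ne_zero (Finset.prod_ne_zero_iff.2 fun j _ => pow_ne_zero _ hy)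
    (det_choose_ne_zero ha) h'.symm

lemma exists_det_near_taylorMatrix {N : ℕ} {a : Fin N → ℕ} (ha : Function.Injective a) :
    ∃ c C : ℝ, 0 < c ∧ 0 < C ∧ ∀ y ∈ Set.Icc (1 / 2 : ℝ) 2, ∀ B : Matrix (Fin N) (Fin N) ℝ,
      (∀ i j, |B i j - taylorMatrix a y i j| ≤ c) → B.det ≠ 0 ∧ |B.det| ≤ C := by
  have hcont : Continuous fun y : ℝ => taylorMatrix a y := by
    unfold taylorMatrix
    fun_prop
  have hdet : Continuous fun B : Fin N → Fin N → ℝ => (Matrix.of B).det :=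
    Continuous.matrix_det (A := fun B : Fin N → Fin N → ℝ => Matrix.of B) continuous_id
  have hK : IsCompact ((fun y : ℝ => taylorMatrix a y) '' Set.Icc (1 / 2 : ℝ) 2) :=
    isCompact_Icc.image hcont
  obtain ⟨c, hc, hsub⟩ := hK.exists_cthickening_subset_open
    (t := {B | (Matrix.of B).det ≠ 0}) (isOpen_ne_fun hdet continuous_const) (by
      rintro _ ⟨y, hy, rfl⟩
      exact det_taylorMatrix_ne_zero ha (by rintro rfl; norm_num at hy))
  obtain ⟨C, hC⟩ := (hK.cthickening (r := c)).exists_bound_of_continuousOn hdet.continuousOn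
  refine ⟨c, max C 1, hc, by positivity, fun y hy B hB => ?_⟩
  have hmem : (B : Fin N → Fin N → ℝ) ∈
      Metric.cthickening c ((fun y : ℝ => taylorMatrix a y) '' Set.Icc (1 / 2 : ℝ) 2) := by
    refine Metric.mem_cthickening_of_dist_le _ (taylorMatrix a y) _ _ ⟨y, hy, rfl⟩ ?_
    exact (dist_pi_le_iff hc.le).2 fun i => (dist_pi_le_iff hc.le).2 fun j => hB i j
  exact ⟨hsub hmem, (hC _ hmem).trans (le_max_left _ _)⟩

/-- A perturbed generalized Vandermonde determinant with well spaced nodes is nonzero and is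
bounded in terms of the diameter of the set of nodes. -/
lemma exists_det_pow_add_bound {N : ℕ} (hN : 2 ≤ N) {a : Fin N → ℕ} (ha : Function.Injective a) :
    ∃ c C : ℝ, 0 < c ∧ c ≤ 1 ∧ 0 < C ∧ ∀ (x : Fin N → ℝ) (θ : Fin N → Fin N → ℝ) (h L δ : ℝ),
      (∀ i, x i ∈ Set.Icc (1 / 2 : ℝ) 2) → 0 < h → (∀ i j, i ≠ j → h ≤ |x i - x j|) →
      (∀ i j, |x i - x j| ≤ L) → L ≤ c → (∀ i j, |θ i j| ≤ δ) → δ ≤ c * h ^ (N - 1) →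
      (Matrix.of fun i j => x i ^ a j + θ i j).det ≠ 0 ∧
        |(Matrix.of fun i j => x i ^ a j + θ i j).det| ≤ C * L ^ (N * (N - 1) / 2) := by
  obtain ⟨c₀, C, hc₀, hC, hdet⟩ := exists_det_near_taylorMatrix ha
  choose C₁ hC₁ hdd using fun j => exists_abs_dividedDiff_pow_sub_le (a j)
  set S : ℝ := ∑ j, C₁ j with hS
  have hS0 : 0 ≤ S := Finset.sum_nonneg fun j _ => hC₁ j
  have hSj : ∀ j, C₁ j ≤ S := fun j => Finset.single_le_sum (fun j _ => hC₁ j) (Finset.mem_univ j)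
  have hN0 : (0 : ℝ) < N := by positivity
  refine ⟨min 1 (c₀ / (S + N)), C, by positivity, min_le_left _ _, hC, ?_⟩
  intro x θ h L δ hx hh hsep hL hLc hθ hδ
  set c := min 1 (c₀ / (S + N)) with hc
  have hcS : S * c + N * c ≤ c₀ := by
    have : c ≤ c₀ / (S + N) := min_le_right _ _
    rw [le_div_iff₀ (by positivity)] at this
    linarith
  have hL1 : L ≤ 1 := hLc.trans (min_le_left _ _)
  have hinj : Function.Injective x := by
    intro i j hij
    by_contra hne
    have := hsep i j hne
    rw [hij, sub_self, abs_zero] at this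
    linarith
  have hh1 : h ≤ 1 := by
    have h01 : (⟨0, by omega⟩ : Fin N) ≠ ⟨1, by omega⟩ := by simp
    exact (hsep _ _ h01).trans ((hL _ _).trans hL1)
  set M : Matrix (Fin N) (Fin N) ℝ := Matrix.of fun i j => x i ^ a j + θ i j with hM
  set D : Matrix (Fin N) (Fin N) ℝ := Matrix.of fun i m =>
    if m ≤ i then Lagrange.nodalWeight (Finset.Iic i) x m else 0 with hD
  have hDM : ∀ i j, (D * M) i j = dividedDiff (Finset.Iic i) x (fun m => x m ^ a j)
      + dividedDiff (Finset.Iic i) x (fun m => θ m j) := by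
    intro i j
    rw [← dividedDiff_add, Matrix.mul_apply, dividedDiff]
    simp only [hD, hM, Matrix.of_apply, ite_mul, zero_mul]
    rw [← Finset.sum_filter]
    congr 1
    ext m
    simp
  have hDdet : D.det = ∏ i, Lagrange.nodalWeight (Finset.Iic i) x i := by
    rw [Matrix.det_of_isLowerTriangular]
    · simp [hD]
    · intro i j hij
      have : i < j := by simpa using hij
      simp [hD, not_le.2 this]
  have hw : ∀ i m : Fin N, m ≤ i → |Lagrange.nodalWeight (Finset.Iic i) x m| ≤ (h ^ (N - 1))⁻¹ := by
    intro i m hmi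
    rw [Lagrange.nodalWeight, Finset.abs_prod]
    have hcard : ((Finset.Iic i).erase m).card = i := by
      rw [Finset.card_erase_of_mem (by simpa using hmi)]; simp
    calc ∏ j ∈ (Finset.Iic i).erase m, |(x m - x j)⁻¹|
        ≤ ∏ j ∈ (Finset.Iic i).erase m, h⁻¹ := by
          refine Finset.prod_le_prod (fun _ _ => abs_nonneg _) fun j hj => ?_
          rw [abs_inv]
          exact inv_anti₀ hh (hsep m j (Finset.ne_of_mem_erase hj).symm)
      _ = (h ^ (i : ℕ))⁻¹ := by rw [Finset.prod_const, hcard, inv_pow]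
      _ ≤ _ := inv_anti₀ (by positivity) (pow_le_pow_of_le_one hh.le hh1 (by omega))
  have hθdd : ∀ i j, |dividedDiff (Finset.Iic i) x (fun m => θ m j)| ≤ N * c := by
    intro i j
    rw [dividedDiff]
    refine (Finset.abs_sum_le_sum_abs _ _).trans ?_
    have hterm : ∀ m ∈ Finset.Iic i, |Lagrange.nodalWeight (Finset.Iic i) x m * θ m j| ≤ c := by
      intro m hm
      rw [abs_mul]
      calc _ ≤ (h ^ (N - 1))⁻¹ * δ := by
            gcongr
            · exact hw i m (by simpa using hm)
            · exact hθ m j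
        _ ≤ (h ^ (N - 1))⁻¹ * (c * h ^ (N - 1)) := by gcongr
        _ = c := by field_simp
    refine (Finset.sum_le_card_nsmul _ _ _ hterm).trans ?_
    rw [nsmul_eq_mul]
    have hc0 : 0 < c := by positivity
    gcongr
    simp
  let i₀ : Fin N := ⟨0, by omega⟩
  have hnear : ∀ i j, |(D * M) i j - taylorMatrix a (x i₀) i j| ≤ c₀ := by
    intro i j
    have hx0 := hx i₀
    have h1 := hdd j (Finset.Iic i) x i (x i₀) L hinj.injOn (by simp)
      (by rw [abs_of_nonneg (by linarith [hx0.1])]; exact hx0.2) hL1 (fun m _ => hL m i₀)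
    have h2 := hθdd i j
    rw [hDM, taylorMatrix, add_sub_right_comm]
    refine (abs_add_le _ _).trans ?_
    have h3 : C₁ j * L ≤ S * c := mul_le_mul (hSj j) hLc ((abs_nonneg _).trans (hL i₀ i₀)) hS0
    linarith
  obtain ⟨hne, hle⟩ := hdet (x i₀) (hx i₀) (D * M) hnear
  rw [Matrix.det_mul] at hne hle
  refine ⟨right_ne_zero_of_mul hne, ?_⟩
  have hL0 : 0 < L := by
    have h01 : (⟨0, by omega⟩ : Fin N) ≠ ⟨1, by omega⟩ := by simp
    exact hh.trans_le ((hsep _ _ h01).trans (hL _ _))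
  have hDlow : (L ^ (N * (N - 1) / 2))⁻¹ ≤ |D.det| := by
    rw [hDdet, Finset.abs_prod]
    have : (L ^ (N * (N - 1) / 2))⁻¹ = ∏ i : Fin N, (L⁻¹) ^ (i : ℕ) := by
      rw [Finset.prod_pow_eq_pow_sum, Fin.sum_univ_eq_sum_range (fun i => i),
        Finset.sum_range_id, inv_pow]
    rw [this]
    refine Finset.prod_le_prod (fun _ _ => by positivity) fun i _ => ?_
    rw [Lagrange.nodalWeight, Finset.abs_prod]
    have hcard : ((Finset.Iic i).erase i).card = i := by
      rw [Finset.card_erase_of_mem (by simp)]; simp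
    rw [show L⁻¹ ^ (i : ℕ) = ∏ j ∈ (Finset.Iic i).erase i, L⁻¹ by
      rw [Finset.prod_const, hcard]]
    refine Finset.prod_le_prod (fun _ _ => by positivity) fun j hj => ?_
    rw [abs_inv]
    exact inv_anti₀ (hh.trans_le (hsep i j (Finset.ne_of_mem_erase hj).symm)) (hL i j)
  rw [abs_mul] at hle
  have hLp : 0 < L ^ (N * (N - 1) / 2) := by positivity
  calc |M.det| = L ^ (N * (N - 1) / 2) * ((L ^ (N * (N - 1) / 2))⁻¹ * |M.det|) := by
        field_simp
    _ ≤ L ^ (N * (N - 1) / 2) * (|D.det| * |M.det|) := by gcongr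
    _ ≤ L ^ (N * (N - 1) / 2) * C := by gcongr
    _ = _ := mul_comm _ _

lemma add_mul_le_orderEmbOfFin {S : Finset ℝ} {g : ℝ}
    (hS : ∀ x ∈ S, ∀ y ∈ S, x ≠ y → g ≤ |x - y|) (i t : ℕ) (hit : i + t < S.card) :
    S.orderEmbOfFin rfl ⟨i, by omega⟩ + t * g ≤ S.orderEmbOfFin rfl ⟨i + t, hit⟩ := by
  induction t with
  | zero => simp
  | succ t ih =>
    have h1 := ih (by omega)
    have hlt : S.orderEmbOfFin rfl ⟨i + t, by omega⟩ < S.orderEmbOfFin rfl ⟨i + (t + 1), hit⟩ :=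
      (S.orderEmbOfFin rfl).strictMono (by simp)
    have h2 := hS _ (S.orderEmbOfFin_mem rfl ⟨i + (t + 1), hit⟩) _
      (S.orderEmbOfFin_mem rfl ⟨i + t, by omega⟩) hlt.ne'
    rw [abs_of_pos (sub_pos.2 hlt)] at h2
    push_cast
    linarith

/-- A `g`-separated set with many elements contains `N` elements that are `h`-separated. -/
lemma exists_separated_of_card_lt {S : Finset ℝ} {g h : ℝ} (hg : 0 < g) {N : ℕ} (hN : 2 ≤ N)
    (hS : ∀ x ∈ S, ∀ y ∈ S, x ≠ y → g ≤ |x - y|) (hcard : (N - 1) * ⌈h / g⌉₊ < S.card) :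
    ∃ f : Fin N → ℝ, (∀ i, f i ∈ S) ∧ ∀ i j, i ≠ j → h ≤ |f i - f j| := by
  set K := ⌈h / g⌉₊ with hK
  have hKh : h ≤ K * g := (div_le_iff₀ hg).1 (Nat.le_ceil _)
  have hlt : ∀ i : Fin N, (i : ℕ) * K < S.card := fun i =>
    (Nat.mul_le_mul_right _ (by omega)).trans_lt hcard
  refine ⟨fun i => S.orderEmbOfFin rfl ⟨i * K, hlt i⟩, fun i => S.orderEmbOfFin_mem rfl _, ?_⟩
  have key : ∀ i j : Fin N, i < j → h ≤ |S.orderEmbOfFin rfl ⟨j * K, hlt j⟩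
      - S.orderEmbOfFin rfl ⟨i * K, hlt i⟩| := by
    intro i j hij
    have e : (i : ℕ) * K + (j - i) * K = j * K := by
      rw [← Nat.add_mul, Nat.add_sub_cancel' hij.le]
    have h1 := add_mul_le_orderEmbOfFin hS (i * K) ((j - i) * K) (by rw [e]; exact hlt j)
    simp only [e] at h1
    have h2 : (K : ℝ) * g ≤ (((j - i) * K : ℕ) : ℝ) * g := by
      have : K ≤ ((j : ℕ) - i) * K := Nat.le_mul_of_pos_left _ (by omega)
      have : (K : ℝ) ≤ (((j - i) * K : ℕ) : ℝ) := by exact_mod_cast this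
      gcongr
    refine le_trans ?_ (le_abs_self _)
    linarith
  intro i j hij
  rcases lt_or_gt_of_ne hij with h' | h'
  · rw [abs_sub_comm]; exact key i j h'
  · exact key j i h'

/-- If no `N` elements of a `g`-separated set in `[1/2, 2]` are `h`-separated and within distance
`L` of each other, then the set is small. -/
lemma card_le_of_forall_not_separated {S : Finset ℝ} {g h L : ℝ} (hg : 0 < g) (hh : 0 < h)
    (hL : 0 < L) {N : ℕ} (hN : 2 ≤ N) (hS : ∀ x ∈ S, ∀ y ∈ S, x ≠ y → g ≤ |x - y|)
    (hI : ∀ x ∈ S, x ∈ Set.Icc (1 / 2 : ℝ) 2)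
    (hno : ∀ f : Fin N → ℝ, (∀ i, f i ∈ S) → (∀ i j, i ≠ j → h ≤ |f i - f j|) →
      ¬ ∀ i j, |f i - f j| ≤ L) :
    (S.card : ℝ) ≤ N * (h / g + 1) * (2 / L + 1) := by
  set K := ⌈h / g⌉₊ with hK
  set cell : ℝ → ℕ := fun x => ⌊(x - 1 / 2) / L⌋₊ with hcell
  have hfib : ∀ b ∈ Finset.range (⌊2 / L⌋₊ + 1),
      (S.filter fun x => cell x = b).card ≤ (N - 1) * K := by
    intro b _
    by_contra! hlt
    obtain ⟨f, hf, hsep⟩ := exists_separated_of_card_lt hg hN (fun x hx y hy =>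
      hS x (Finset.mem_filter.1 hx).1 y (Finset.mem_filter.1 hy).1) hlt
    refine hno f (fun i => (Finset.mem_filter.1 (hf i)).1) hsep fun i j => ?_
    have hb : ∀ i, b * L ≤ f i - 1 / 2 ∧ f i - 1 / 2 < (b + 1) * L := by
      intro i
      obtain ⟨h1, h2⟩ := Finset.mem_filter.1 (hf i)
      have h0 : 0 ≤ (f i - 1 / 2) / L := div_nonneg (by linarith [(hI _ h1).1]) hL.le
      have := (Nat.floor_eq_iff h0).1 h2
      exact ⟨(le_div_iff₀ hL).1 this.1, (div_lt_iff₀ hL).1 this.2⟩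
    rw [abs_le]
    constructor <;> linarith [(hb i).1, (hb i).2, (hb j).1, (hb j).2]
  have hmaps : ∀ x ∈ S, cell x ∈ Finset.range (⌊2 / L⌋₊ + 1) := by
    intro x hx
    rw [Finset.mem_range, Nat.lt_succ_iff]
    refine Nat.floor_le_floor ?_
    have := (hI x hx).2
    gcongr
    linarith
  have hcard := Finset.card_eq_sum_card_fiberwise hmaps
  have h1 : S.card ≤ (⌊2 / L⌋₊ + 1) * ((N - 1) * K) := by
    rw [hcard]
    refine (Finset.sum_le_card_nsmul _ _ _ hfib).trans ?_
    simp
  have h2 : (K : ℝ) ≤ h / g + 1 := (Nat.ceil_lt_add_one (by positivity)).le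
  have h3 : (⌊2 / L⌋₊ : ℝ) ≤ 2 / L := Nat.floor_le (by positivity)
  have h4 : ((N - 1 : ℕ) : ℝ) ≤ N := by exact_mod_cast Nat.sub_le _ _
  calc (S.card : ℝ) ≤ (⌊2 / L⌋₊ + 1) * ((N - 1 : ℕ) * K) := by exact_mod_cast h1
    _ ≤ (2 / L + 1) * (N * (h / g + 1)) := by gcongr
    _ = _ := by ring

/-- Well spaced solutions of `v * e ^ k = u * d ^ k + 1` in a dyadic box cannot lie too close to
each other. -/
lemma one_le_of_separated_solutions (A k : ℕ) (hA : A < k) :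
    ∃ c C : ℝ, 0 < c ∧ c ≤ 1 ∧ 1 ≤ C ∧
      ∀ (D E W h L : ℝ) (d e u v : Fin ((A + 1) + (A + 1)) → ℕ), 0 < D → 0 < E → 0 < W →
      (∀ i, D ≤ d i ∧ d i ≤ 2 * D) → (∀ i, E ≤ e i ∧ e i ≤ 2 * E) →
      (∀ i, v i * e i ^ k = u i * d i ^ k + 1) →
      (∀ i, W ≤ (v i * e i ^ k : ℕ) ∧ (v i * e i ^ k : ℕ) ≤ 2 * W) → 0 < h →
      (∀ i j, i ≠ j → h ≤ |(e i / E) / (d i / D) - (e j / E) / (d j / D)|) →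
      (∀ i j, |(e i / E) / (d i / D) - (e j / E) / (d j / D)| ≤ L) → L ≤ c →
      C ≤ W * h ^ (2 * A + 1) →
      1 ≤ C * (W ^ 2 * (D * E) ^ A / (D * E) ^ k * L ^ (2 * A + 1)) ^ (A + 1) := by
  set a : Fin ((A + 1) + (A + 1)) → ℕ :=
    Fin.append (fun j : Fin (A + 1) => (j : ℕ)) (fun j : Fin (A + 1) => k + j) with ha
  have hinj : Function.Injective a := by
    intro i j
    refine Fin.addCases (fun i => ?_) (fun i => ?_) i <;>
      refine Fin.addCases (fun j => ?_) (fun j => ?_) j <;>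
      simp only [ha, Fin.append_left, Fin.append_right] <;> intro hij
    · rw [Fin.ext hij]
    · omega
    · omega
    · rw [Fin.ext (by omega : (i : ℕ) = j)]
  have hsum : ∑ j, a j = (A + 1) * (A + k) := by
    rw [Fin.sum_univ_add]
    simp only [ha, Fin.append_left, Fin.append_right, Finset.sum_add_distrib, Finset.sum_const,
      Finset.card_univ, Fintype.card_fin, smul_eq_mul]
    have h2 := Finset.sum_range_id_mul_two (A + 1)
    rw [← Fin.sum_univ_eq_sum_range (fun i => i)] at h2
    rw [Nat.add_sub_cancel] at h2
    linarith
  obtain ⟨c, C, hc, hc1, hC, hdet⟩ :=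
    exists_det_pow_add_bound (N := (A + 1) + (A + 1)) (by omega) hinj
  refine ⟨c, max (max 1 (C * 4 ^ ((A + 1) * (A + 1)))) (2 ^ k * 2 ^ A / c), hc, hc1,
    (le_max_left _ _).trans (le_max_left _ _), ?_⟩
  intro D E W h L d e u v hD hE hW hd he huv hvW hh hsep hclose hLc hCh
  set x : Fin ((A + 1) + (A + 1)) → ℝ := fun i => (e i / E) / (d i / D) with hx
  set η : Fin ((A + 1) + (A + 1)) → ℝ := fun i => (D / E) ^ k / (v i * d i ^ k) with hη
  set θ : Fin ((A + 1) + (A + 1)) → Fin ((A + 1) + (A + 1)) → ℝ := fun i =>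
    Fin.append (fun _ => 0) (fun j : Fin (A + 1) => - (η i * x i ^ (j : ℕ))) with hθ
  have hd0 : ∀ i, (0 : ℝ) < d i := fun i => hD.trans_le (hd i).1
  have he0 : ∀ i, (0 : ℝ) < e i := fun i => hE.trans_le (he i).1
  have hv0 : ∀ i, (0 : ℝ) < v i := by
    intro i
    have h1 := hW.trans_le (hvW i).1
    have h2 : 0 < v i * e i ^ k := by exact_mod_cast h1
    exact_mod_cast Nat.pos_of_mul_pos_right h2
  have hxI : ∀ i, x i ∈ Set.Icc (1 / 2 : ℝ) 2 := by
    intro i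
    have h1 : 1 ≤ e i / E := (one_le_div hE).2 (he i).1
    have h2 : e i / E ≤ 2 := (div_le_iff₀ hE).2 (he i).2
    have h3 : 1 ≤ d i / D := (one_le_div hD).2 (hd i).1
    have h4 : d i / D ≤ 2 := (div_le_iff₀ hD).2 (hd i).2
    refine ⟨?_, ?_⟩
    · simp only [hx]
      rw [le_div_iff₀ (by linarith)]
      linarith
    · simp only [hx]
      rw [div_le_iff₀ (by linarith)]
      linarith
  have hηb : ∀ i, 0 ≤ η i ∧ η i ≤ 2 ^ k / W := by
    intro i
    have hdi := hd0 i
    have hei := he0 i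
    have hvi := hv0 i
    refine ⟨by positivity, ?_⟩
    have h1 := (hvW i).1
    push_cast at h1
    simp only [hη]
    rw [div_pow, div_div, div_le_div_iff₀ (by positivity) hW]
    have h2 : D ^ k ≤ (d i : ℝ) ^ k := by gcongr; exact (hd i).1
    have h3 : (e i : ℝ) ^ k ≤ 2 ^ k * E ^ k := by
      rw [← mul_pow]; gcongr; exact (he i).2
    calc D ^ k * W ≤ (d i : ℝ) ^ k * (v i * (2 ^ k * E ^ k)) := by
          gcongr
          exact h1.trans (by gcongr)
      _ = _ := by ring
  have hθb : ∀ i j, |θ i j| ≤ 2 ^ k / W * 2 ^ A := by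
    intro i j
    refine Fin.addCases (fun j => ?_) (fun j => ?_) j
    · simp only [hθ, Fin.append_left, abs_zero]
      positivity
    · simp only [hθ, Fin.append_right, abs_neg]
      have hx0 : 0 ≤ x i := by linarith [(hxI i).1]
      rw [abs_of_nonneg (mul_nonneg (hηb i).1 (pow_nonneg hx0 _))]
      have h1 : x i ^ (j : ℕ) ≤ 2 ^ A :=
        (pow_le_pow_left₀ hx0 (hxI i).2 _).trans (pow_le_pow_right₀ (by norm_num) (by omega))
      exact mul_le_mul (hηb i).2 h1 (pow_nonneg hx0 _) (by positivity)
  have hδ : 2 ^ k / W * 2 ^ A ≤ c * h ^ ((A + 1) + (A + 1) - 1) := by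
    have h1 := (le_max_right _ _).trans hCh
    rw [div_le_iff₀ hc] at h1
    rw [show (A + 1) + (A + 1) - 1 = 2 * A + 1 by omega, div_mul_eq_mul_div, div_le_iff₀ hW]
    linarith
  obtain ⟨hne, hle⟩ := hdet x θ h L _ hxI hh hsep hclose hLc hθb hδ
  set V := (Matrix.of fun i j => x i ^ a j + θ i j) with hV
  set I : Matrix (Fin ((A + 1) + (A + 1))) (Fin ((A + 1) + (A + 1))) ℤ := Matrix.of fun i =>
    Fin.append (fun j : Fin (A + 1) => (d i : ℤ) ^ (A - j) * e i ^ (j : ℕ) * v i)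
      (fun j : Fin (A + 1) => (d i : ℤ) ^ (A - j) * e i ^ (j : ℕ) * u i) with hI
  have hIV : ∀ i j, ((I i j : ℤ) : ℝ) = (d i ^ A * v i) * ((E / D) ^ a j * V i j) := by
    intro i j
    have hdi := hd0 i
    have hvi := hv0 i
    have hex : E / D * x i = e i / d i := by
      simp only [hx]
      field_simp
    have hdA : ∀ j : Fin (A + 1), (d i : ℝ) ^ A = d i ^ (A - j) * d i ^ (j : ℕ) := fun j => by
      rw [← pow_add, Nat.sub_add_cancel (by omega)]
    refine Fin.addCases (fun j => ?_) (fun j => ?_) j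
    · simp only [hI, hV, hθ, ha, Matrix.of_apply, Fin.append_left, add_zero]
      push_cast
      rw [← mul_pow, hex, div_pow, hdA j]
      field_simp
    · simp only [hI, hV, hθ, ha, Matrix.of_apply, Fin.append_right]
      push_cast
      have e1 : (E / D) ^ (k + j) * (x i ^ (k + j) + -(η i * x i ^ (j : ℕ)))
          = (E / D * x i) ^ (j : ℕ) * ((E / D * x i) ^ k - (E / D) ^ k * η i) := by
        rw [pow_add, pow_add, mul_pow, mul_pow]; ring
      have e2 : (E / D) ^ k * η i = 1 / (v i * d i ^ k) := by
        simp only [hη, div_pow]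
        field_simp
      have e3 : (v i : ℝ) * e i ^ k = u i * d i ^ k + 1 := by exact_mod_cast huv i
      have e4 : (v i : ℝ) * ((e i / d i) ^ k - 1 / (v i * d i ^ k)) = u i := by
        rw [div_pow]
        field_simp
        linarith
      rw [e1, e2, hex, hdA j, div_pow]
      calc _ = (d i : ℝ) ^ (A - j) * e i ^ (j : ℕ)
            * (v i * ((e i / d i) ^ k - 1 / (v i * d i ^ k))) := by rw [e4]
        _ = _ := by field_simp
  have hIdet : ((I.det : ℤ) : ℝ)
      = (∏ i, ((d i : ℝ) ^ A * v i)) * ((E / D) ^ ((A + 1) * (A + k)) * V.det) := by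
    have h1 : ((I.det : ℤ) : ℝ) = (Matrix.of fun i j =>
        (d i ^ A * v i : ℝ) * (Matrix.of fun i j => (E / D) ^ a j * V i j) i j).det := by
      rw [Int.cast_det]
      congr 1
      ext i j
      simpa using hIV i j
    rw [h1, Matrix.det_mul_column, Matrix.det_mul_row, Finset.prod_pow_eq_pow_sum, hsum]
  have hI1 : (1 : ℝ) ≤ |((I.det : ℤ) : ℝ)| := by
    have : I.det ≠ 0 := by
      intro h0
      rw [h0, Int.cast_zero] at hIdet
      have : (∏ i, ((d i : ℝ) ^ A * v i)) * ((E / D) ^ ((A + 1) * (A + k)) * V.det) ≠ 0 := by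
        refine mul_ne_zero (Finset.prod_ne_zero_iff.2 fun i _ => ?_) (mul_ne_zero ?_ hne)
        · have := hd0 i
          have := hv0 i
          positivity
        · positivity
      exact this hIdet.symm
    exact_mod_cast Int.one_le_abs this
  have hprod : |∏ i, ((d i : ℝ) ^ A * v i)| ≤ ((2 * D) ^ A * (2 * W / E ^ k)) ^ (2 * (A + 1)) := by
    rw [Finset.abs_prod]
    refine (Finset.prod_le_prod (g := fun _ => (2 * D) ^ A * (2 * W / E ^ k))
      (fun i _ => abs_nonneg _) fun i _ => ?_).trans ?_
    · have hdi := hd0 i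
      have hvi := hv0 i
      rw [abs_of_nonneg (by positivity)]
      have h1 := (hvW i).2
      push_cast at h1
      have h2 : (v i : ℝ) ≤ 2 * W / E ^ k := by
        rw [le_div_iff₀ (by positivity)]
        refine le_trans ?_ h1
        have := (he i).1
        gcongr
      have := (hd i).2
      gcongr
    · rw [Finset.prod_const, Finset.card_univ, Fintype.card_fin, two_mul (A + 1)]
  rw [hIdet, abs_mul, abs_mul, abs_of_pos (by positivity : 0 < (E / D) ^ ((A + 1) * (A + k)))] at hI1
  have hL0 : 0 ≤ L := (abs_nonneg _).trans (hclose 0 0)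
  refine hI1.trans ?_
  have hNN : ((A + 1) + (A + 1)) * ((A + 1) + (A + 1) - 1) / 2 = (2 * A + 1) * (A + 1) := by
    rw [show ((A + 1) + (A + 1)) * ((A + 1) + (A + 1) - 1) = 2 * ((2 * A + 1) * (A + 1)) by
      rw [show (A + 1) + (A + 1) - 1 = 2 * A + 1 by omega]; ring]
    simp
  rw [hNN] at hle
  calc _ ≤ ((2 * D) ^ A * (2 * W / E ^ k)) ^ (2 * (A + 1)) *
        ((E / D) ^ ((A + 1) * (A + k)) * (C * L ^ ((2 * A + 1) * (A + 1)))) := by gcongr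
    _ = C * (((2 * D) ^ A * (2 * W / E ^ k)) ^ 2 * (E / D) ^ (A + k) * L ^ (2 * A + 1)) ^ (A + 1) := by
        rw [pow_mul, mul_comm (A + 1) (A + k), pow_mul (E / D), pow_mul L, mul_pow, mul_pow]
        ring
    _ = C * (4 ^ (A + 1) * (W ^ 2 * (D * E) ^ A / (D * E) ^ k * L ^ (2 * A + 1))) ^ (A + 1) := by
        congr 2
        have h4 : (4 : ℝ) ^ (A + 1) = (2 ^ A * 2) ^ 2 := by
          rw [← pow_succ, ← pow_mul, mul_comm (A + 1) 2, pow_mul]; norm_num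
        rw [h4]
        simp only [mul_pow, div_pow, pow_add]
        field_simp
    _ = (C * 4 ^ ((A + 1) * (A + 1))) *
        (W ^ 2 * (D * E) ^ A / (D * E) ^ k * L ^ (2 * A + 1)) ^ (A + 1) := by
        rw [mul_pow, pow_mul]; ring
    _ ≤ _ := by
        gcongr
        exact (le_max_right _ _).trans (le_max_left _ _)

lemma coprime_of_pow_dvd_succ {k d e n : ℕ} (hk : k ≠ 0) (hd : d ^ k ∣ n) (he : e ^ k ∣ n + 1) :
    Nat.Coprime d e := by
  have h : Nat.Coprime n (n + 1) := by simp
  exact (Nat.coprime_pow_left_iff (Nat.pos_of_ne_zero hk) _ _).1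
    ((Nat.coprime_pow_right_iff (Nat.pos_of_ne_zero hk) _ _).1
      (Nat.Coprime.coprime_dvd_left hd (Nat.Coprime.coprime_dvd_right he h)))

/-- Distinct reduced fractions with bounded denominators are well separated. -/
lemma inv_le_abs_sub_of_coprime {D E : ℕ} (hD : 0 < D) (hE : 0 < E) {p q : ℕ × ℕ}
    (hp : Nat.Coprime p.1 p.2) (hq : Nat.Coprime q.1 q.2) (hpq : p ≠ q)
    (hp1 : D ≤ p.1 ∧ p.1 < 2 * D) (hq1 : D ≤ q.1 ∧ q.1 < 2 * D) :
    (4 * ((D : ℝ) * E))⁻¹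
      ≤ |(p.2 / (E : ℝ)) / (p.1 / (D : ℝ)) - (q.2 / (E : ℝ)) / (q.1 / (D : ℝ))| := by
  have hD' : (0 : ℝ) < D := by exact_mod_cast hD
  have hE' : (0 : ℝ) < E := by exact_mod_cast hE
  have hp0 : (0 : ℝ) < p.1 := by exact_mod_cast hD.trans_le hp1.1
  have hq0 : (0 : ℝ) < q.1 := by exact_mod_cast hD.trans_le hq1.1
  have hne : (p.2 * q.1 : ℤ) - q.2 * p.1 ≠ 0 := by
    intro h
    have h' : p.2 * q.1 = q.2 * p.1 := by exact_mod_cast sub_eq_zero.1 h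
    have h1 : p.1 = q.1 := by
      refine Nat.dvd_antisymm ?_ ?_
      · exact hp.dvd_of_dvd_mul_left (h' ▸ Dvd.intro_left _ rfl)
      · exact hq.dvd_of_dvd_mul_left (h' ▸ Dvd.intro_left _ rfl)
    refine hpq (Prod.ext h1 ?_)
    rw [h1] at h'
    exact Nat.eq_of_mul_eq_mul_right (hD.trans_le hq1.1) h'
  have h1 : (1 : ℝ) ≤ |(p.2 : ℝ) * q.1 - q.2 * p.1| := by exact_mod_cast Int.one_le_abs hne
  have e : (p.2 / (E : ℝ)) / (p.1 / (D : ℝ)) - (q.2 / (E : ℝ)) / (q.1 / (D : ℝ))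
      = ((p.2 : ℝ) * q.1 - q.2 * p.1) * (D / (E * (p.1 * q.1))) := by
    field_simp
  rw [e, abs_mul, abs_of_pos (by positivity : (0 : ℝ) < D / (E * (p.1 * q.1)))]
  refine le_trans ?_ (mul_le_mul_of_nonneg_right h1 (by positivity))
  rw [one_mul, inv_eq_one_div, div_le_div_iff₀ (by positivity) (by positivity)]
  have hp2 : (p.1 : ℝ) ≤ 2 * D := by exact_mod_cast hp1.2.le
  have hq2 : (q.1 : ℝ) ≤ 2 * D := by exact_mod_cast hq1.2.le
  calc 1 * ((E : ℝ) * (p.1 * q.1)) ≤ 1 * (E * ((2 * D) * (2 * D))) := by gcongr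
    _ = _ := by ring

lemma exists_card_pairs_le (A k : ℕ) (hA : A < k) :
    ∃ c C : ℝ, 0 < c ∧ c ≤ 1 ∧ 1 ≤ C ∧ ∀ (D E W : ℕ) (P : Finset (ℕ × ℕ)) (h L : ℝ),
      0 < D → 0 < E → 0 < W →
      (∀ p ∈ P, (D ≤ p.1 ∧ p.1 < 2 * D) ∧ (E ≤ p.2 ∧ p.2 < 2 * E) ∧
        ∃ n, W ≤ n ∧ n < 2 * W ∧ p.1 ^ k ∣ n ∧ p.2 ^ k ∣ n + 1) →
      0 < h → 0 < L → L ≤ c → C ≤ W * h ^ (2 * A + 1) →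
      C * ((W : ℝ) ^ 2 * ((D : ℝ) * E) ^ A / ((D : ℝ) * E) ^ k * L ^ (2 * A + 1)) ^ (A + 1) < 1 →
      (P.card : ℝ) ≤ (2 * (A + 1)) * (4 * (h * (D * E)) + 1) * (2 / L + 1) := by
  obtain ⟨c, C, hc, hc1, hC, key⟩ := one_le_of_separated_solutions A k hA
  refine ⟨c, C, hc, hc1, hC, fun D E W P h L hD hE hW hP hh hL hLc hCh hlt => ?_⟩
  have hD' : (0 : ℝ) < D := by exact_mod_cast hD
  have hE' : (0 : ℝ) < E := by exact_mod_cast hE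
  have hW' : (0 : ℝ) < W := by exact_mod_cast hW
  set x : ℕ × ℕ → ℝ := fun p => (p.2 / (E : ℝ)) / (p.1 / (D : ℝ)) with hx
  have hcop : ∀ p ∈ P, Nat.Coprime p.1 p.2 := fun p hp => by
    obtain ⟨-, -, n, -, -, h1, h2⟩ := hP p hp
    exact coprime_of_pow_dvd_succ (by omega) h1 h2
  have hg0 : (0 : ℝ) < (4 * ((D : ℝ) * E))⁻¹ := by positivity
  have hgap : ∀ p ∈ P, ∀ q ∈ P, p ≠ q → (4 * ((D : ℝ) * E))⁻¹ ≤ |x p - x q| :=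
    fun p hp q hq hpq => inv_le_abs_sub_of_coprime hD hE (hcop p hp) (hcop q hq) hpq
      (hP p hp).1 (hP q hq).1
  have hinj : Set.InjOn x P := by
    intro p hp q hq hpq
    by_contra hne
    have := hgap p hp q hq hne
    rw [hpq, sub_self, abs_zero] at this
    linarith
  have hcard := card_le_of_forall_not_separated (S := P.image x) hg0 hh hL
    (N := (A + 1) + (A + 1)) (by omega) (by
      intro a ha b hb hab
      obtain ⟨p, hp, rfl⟩ := Finset.mem_image.1 ha
      obtain ⟨q, hq, rfl⟩ := Finset.mem_image.1 hb
      exact hgap p hp q hq fun h => hab (by rw [h])) (by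
      intro a ha
      obtain ⟨p, hp, rfl⟩ := Finset.mem_image.1 ha
      obtain ⟨⟨h1, h2⟩, ⟨h3, h4⟩, -⟩ := hP p hp
      have h1' : (D : ℝ) ≤ p.1 := by exact_mod_cast h1
      have h2' : (p.1 : ℝ) ≤ 2 * D := by exact_mod_cast h2.le
      have h3' : (E : ℝ) ≤ p.2 := by exact_mod_cast h3
      have h4' : (p.2 : ℝ) ≤ 2 * E := by exact_mod_cast h4.le
      have g1 : 1 ≤ p.2 / (E : ℝ) := (one_le_div hE').2 h3'
      have g2 : p.2 / (E : ℝ) ≤ 2 := (div_le_iff₀ hE').2 h4'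
      have g3 : 1 ≤ p.1 / (D : ℝ) := (one_le_div hD').2 h1'
      have g4 : p.1 / (D : ℝ) ≤ 2 := (div_le_iff₀ hD').2 h2'
      constructor
      · simp only [hx]
        rw [le_div_iff₀ (by linarith)]
        linarith
      · simp only [hx]
        rw [div_le_iff₀ (by linarith)]
        linarith) (by
      intro f hf hsep hclose
      have hf' : ∀ i, ∃ p ∈ P, x p = f i := fun i => by simpa using hf i
      choose p hpP hpf using hf'
      have hex : ∀ i, ∃ u v : ℕ, v * (p i).2 ^ k = u * (p i).1 ^ k + 1 ∧
          W ≤ v * (p i).2 ^ k ∧ v * (p i).2 ^ k ≤ 2 * W := by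
        intro i
        obtain ⟨-, -, n, h1, h2, ⟨u, hu⟩, ⟨v, hv⟩⟩ := hP _ (hpP i)
        refine ⟨u, v, ?_, ?_, ?_⟩
        · rw [mul_comm v, ← hv, hu, mul_comm]
        · rw [mul_comm v, ← hv]; omega
        · rw [mul_comm v, ← hv]; omega
      choose u v huv hvW1 hvW2 using hex
      refine absurd (key D E W h L (fun i => (p i).1) (fun i => (p i).2) u v hD' hE' hW'
        (fun i => ?_) (fun i => ?_) huv (fun i => ⟨by exact_mod_cast hvW1 i, by
          exact_mod_cast hvW2 i⟩) hh (fun i j hij => ?_) (fun i j => ?_) hLc hCh) (not_le.2 hlt)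
      · have := (hP _ (hpP i)).1
        exact ⟨by exact_mod_cast this.1, by exact_mod_cast this.2.le⟩
      · have := (hP _ (hpP i)).2.1
        exact ⟨by exact_mod_cast this.1, by exact_mod_cast this.2.le⟩
      · have := hsep i j hij
        rwa [← hpf i, ← hpf j] at this
      · have := hclose i j
        rwa [← hpf i, ← hpf j] at this)
  rw [Finset.card_image_of_injOn hinj] at hcard
  refine hcard.trans (le_of_eq ?_)
  rw [div_inv_eq_mul]
  push_cast
  ring

/-- The bound for the number of pairs `(d, e)` in a dyadic box whose `k`-th powers divide two
consecutive integers of size about `W`. -/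
lemma exists_card_pairs_le_rpow (k : ℕ) (hk : 2 ≤ k) :
    ∃ C : ℝ, 0 < C ∧ ∀ (D E W : ℕ) (P : Finset (ℕ × ℕ)), 0 < D → 0 < E → 0 < W →
      (∀ p ∈ P, (D ≤ p.1 ∧ p.1 < 2 * D) ∧ (E ≤ p.2 ∧ p.2 < 2 * E) ∧
        ∃ n, W ≤ n ∧ n < 2 * W ∧ p.1 ^ k ∣ n ∧ p.2 ^ k ∣ n + 1) →
      (W : ℝ) ^ (14 / (9 * (k : ℝ))) ≤ 4 * (D * E) →
      (P.card : ℝ) ≤ C * (W : ℝ) ^ (14 / (9 * (k : ℝ))) := by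
  obtain ⟨A, hA1, hA2, hA3⟩ : ∃ A : ℕ, 2 * k ≤ 7 * A + 7 ∧ 14 * A ≤ 5 * k ∧ 3 * A + 1 ≤ k :=
    ⟨(2 * k - 1) / 7, by omega, by omega, by omega⟩
  obtain ⟨c, C, hc, hc1, hC, key⟩ := exists_card_pairs_le A k (by omega)
  set T : ℝ := 2 * A + 1 with hT
  have hT0 : 0 < T := by positivity
  have hTn : ((2 * A + 1 : ℕ) : ℝ) = T := by push_cast; rfl
  have hk0 : (0 : ℝ) < k := by positivity
  set y : ℝ := 14 / (9 * (k : ℝ)) with hy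
  have hy0 : 0 < y := by positivity
  have hyk : y * k = 14 / 9 := by rw [hy]; field_simp
  have hA1' : (2 : ℝ) * k ≤ 7 * A + 7 := by exact_mod_cast hA1
  have hA2' : (14 : ℝ) * A ≤ 5 * k := by exact_mod_cast hA2
  have hA3' : (3 : ℝ) * A + 1 ≤ k := by exact_mod_cast hA3
  set c₁ : ℝ := C ^ (1 / T) with hc₁
  set c₂ : ℝ := (2 * C) ^ (1 / T) with hc₂
  have hc₁0 : 0 < c₁ := by positivity
  have hc₂0 : 0 < c₂ := by positivity
  set b₁ : ℝ := (1 / 4 : ℝ) ^ (-((k - A) / T)) with hb₁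
  set b₂ : ℝ := (1 / 4 : ℝ) ^ (1 - (k - A) / T) with hb₂
  have hb₁0 : 0 < b₁ := by positivity
  have hb₂0 : 0 < b₂ := by positivity
  refine ⟨(2 * (A + 1)) * ((16 * c₁ + 1) * (2 / c + 1) + 2 * c₂ * (4 * c₁ * b₂ + b₁)),
    by positivity, fun D E W P hD hE hW hP hDE => ?_⟩
  have hD' : (0 : ℝ) < D := by exact_mod_cast hD
  have hE' : (0 : ℝ) < E := by exact_mod_cast hE
  have hW' : (1 : ℝ) ≤ W := by exact_mod_cast hW
  have hW0 : (0 : ℝ) < W := by linarith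
  rcases P.eq_empty_or_nonempty with rfl | ⟨p₀, hp₀⟩
  · simp only [Finset.card_empty, Nat.cast_zero]
    positivity
  set Q : ℝ := (D : ℝ) * E with hQ
  have hQ0 : 0 < Q := by positivity
  have hQlow : (1 / 4) * (W : ℝ) ^ y ≤ Q := by linarith
  have hQup : Q ≤ 4 * (W : ℝ) ^ (2 / (k : ℝ)) := by
    obtain ⟨⟨h1, -⟩, ⟨h2, -⟩, n, h3, h4, h5, h6⟩ := hP p₀ hp₀
    have h7 : D ^ k ≤ 2 * W :=
      (Nat.pow_le_pow_left h1 k).trans ((Nat.le_of_dvd (by omega) h5).trans h4.le)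
    have h8 : E ^ k ≤ 2 * W :=
      (Nat.pow_le_pow_left h2 k).trans ((Nat.le_of_dvd (by omega) h6).trans h4)
    have h9 : Q ^ k ≤ 4 ^ k * (W : ℝ) ^ 2 := by
      have h7' : (D : ℝ) ^ k ≤ 2 * W := by exact_mod_cast h7
      have h8' : (E : ℝ) ^ k ≤ 2 * W := by exact_mod_cast h8
      rw [hQ, mul_pow]
      calc (D : ℝ) ^ k * (E : ℝ) ^ k ≤ (2 * W) * (2 * W) := by gcongr
        _ = 4 ^ 1 * (W : ℝ) ^ 2 := by ring
        _ ≤ 4 ^ k * (W : ℝ) ^ 2 := by gcongr <;> [norm_num; omega]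
    refine le_of_pow_le_pow_left₀ (by omega : k ≠ 0) (by positivity) (h9.trans (le_of_eq ?_))
    rw [mul_pow, ← Real.rpow_mul_natCast hW0.le]
    congr 1
    rw [div_mul_cancel₀ _ hk0.ne']
    norm_cast
  set h : ℝ := c₁ * (W : ℝ) ^ (-(1 / T)) with hh
  have hh0 : 0 < h := by positivity
  have hhT : C ≤ W * h ^ (2 * A + 1) := by
    rw [← Real.rpow_natCast, hTn, hh, Real.mul_rpow hc₁0.le (by positivity), hc₁,
      ← Real.rpow_mul (by linarith), ← Real.rpow_mul hW0.le]
    have e1 : 1 / T * T = 1 := by field_simp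
    have e2 : -(1 / T) * T = -1 := by field_simp
    rw [e1, e2, Real.rpow_one, Real.rpow_neg_one]
    field_simp
    exact le_rfl
  set R : ℝ := c₂ * ((W : ℝ) ^ (2 / T) * Q ^ (-((k - A) / T))) with hR
  have hR0 : 0 < R := by positivity
  set L : ℝ := min c R⁻¹ with hL
  have hL0 : 0 < L := by positivity
  have hRT : R ^ (2 * A + 1) = 2 * C * ((W : ℝ) ^ 2 * Q ^ A / Q ^ k) := by
    rw [← Real.rpow_natCast, hTn, hR, Real.mul_rpow hc₂0.le (by positivity),
      Real.mul_rpow (by positivity) (by positivity), hc₂, ← Real.rpow_mul (by linarith),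
      ← Real.rpow_mul hW0.le, ← Real.rpow_mul hQ0.le]
    have e1 : 1 / T * T = 1 := by field_simp
    have e2 : 2 / T * T = (2 : ℕ) := by push_cast; field_simp
    have e3 : -((k - A) / T) * T = A - k := by field_simp; ring
    rw [e1, e2, e3, Real.rpow_one, Real.rpow_natCast, Real.rpow_sub hQ0, Real.rpow_natCast,
      Real.rpow_natCast]
    ring
  have hlt : C * ((W : ℝ) ^ 2 * Q ^ A / Q ^ k * L ^ (2 * A + 1)) ^ (A + 1) < 1 := by
    have h1 : L ^ (2 * A + 1) ≤ (2 * C * ((W : ℝ) ^ 2 * Q ^ A / Q ^ k))⁻¹ := by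
      rw [← hRT, ← inv_pow]
      gcongr
      exact min_le_right _ _
    have h2 : (W : ℝ) ^ 2 * Q ^ A / Q ^ k * L ^ (2 * A + 1) ≤ (2 * C)⁻¹ := by
      refine (mul_le_mul_of_nonneg_left h1 (by positivity)).trans (le_of_eq ?_)
      field_simp
    have h3 : (2 * C)⁻¹ ≤ 1 := inv_le_one_of_one_le₀ (by linarith)
    calc _ ≤ C * ((2 * C)⁻¹) ^ (A + 1) := by gcongr
      _ ≤ C * (2 * C)⁻¹ := by
        gcongr
        exact pow_le_of_le_one (by positivity) h3 (by omega)
      _ < 1 := by rw [← div_eq_mul_inv, div_lt_one (by linarith)]; linarith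
  have hfin := key D E W P h L hD hE hW hP hh0 hL0 (min_le_left _ _) hhT hlt
  have hLinv : 2 / L + 1 ≤ (2 / c + 1) + 2 * R := by
    rcases min_choice c R⁻¹ with hm | hm
    · rw [hL, hm]; linarith
    · rw [hL, hm, div_inv_eq_mul]
      have : 0 ≤ 2 / c := by positivity
      linarith
  have hone : (1 : ℝ) ≤ (W : ℝ) ^ y := Real.one_le_rpow hW' hy0.le
  have t2 : h * Q ≤ 4 * c₁ * (W : ℝ) ^ y := by
    have hexp : -(1 / T) + 2 / k ≤ y := by
      rw [hy, ← sub_nonneg]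
      have : 14 / (9 * (k : ℝ)) - (-(1 / T) + 2 / k) = (9 * k - 4 * T) / (9 * k * T) := by
        field_simp; ring
      rw [this]
      refine div_nonneg ?_ (by positivity)
      rw [hT]; linarith
    calc h * Q ≤ c₁ * (W : ℝ) ^ (-(1 / T)) * (4 * (W : ℝ) ^ (2 / (k : ℝ))) := by gcongr
      _ = 4 * c₁ * (W : ℝ) ^ (-(1 / T) + 2 / k) := by rw [Real.rpow_add hW0]; ring
      _ ≤ _ := by gcongr
  have hQneg : ∀ s : ℝ, s ≤ 0 → Q ^ s ≤ (1 / 4 : ℝ) ^ s * (W : ℝ) ^ (y * s) := by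
    intro s hs
    rw [Real.rpow_mul hW0.le, ← Real.mul_rpow (by norm_num) (by positivity)]
    exact Real.rpow_le_rpow_of_nonpos (by positivity) hQlow hs
  have t3 : R ≤ c₂ * b₁ * (W : ℝ) ^ y := by
    have hs : -(((k : ℝ) - A) / T) ≤ 0 := neg_nonpos.2 (div_nonneg (by linarith) hT0.le)
    have hexp : 2 / T + y * -((k - A) / T) ≤ y := by
      have : 2 / T + y * -((k - A) / T) = (2 - y * k + y * A) / T := by field_simp; ring
      rw [this, hyk, div_le_iff₀ hT0, hT]
      have : 4 / 9 ≤ y * (A + 1) := by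
        rw [hy, div_mul_eq_mul_div, le_div_iff₀ (by positivity)]
        linarith
      linarith
    calc R ≤ c₂ * ((W : ℝ) ^ (2 / T) * (b₁ * (W : ℝ) ^ (y * -((k - A) / T)))) := by
          rw [hR]; gcongr; exact hQneg _ hs
      _ = c₂ * b₁ * (W : ℝ) ^ (2 / T + y * -((k - A) / T)) := by rw [Real.rpow_add hW0]; ring
      _ ≤ _ := by gcongr
  have t4 : h * Q * R ≤ c₁ * c₂ * b₂ * (W : ℝ) ^ y := by
    have hs : 1 - ((k : ℝ) - A) / T ≤ 0 := by
      rw [sub_nonpos, le_div_iff₀ hT0, hT]; linarith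
    have hexp : 1 / T + y * (1 - (k - A) / T) ≤ y := by
      have : 1 / T + y * (1 - (k - A) / T) = y + (1 - y * k + y * A) / T := by field_simp; ring
      rw [this, hyk]
      have h1 : y * A ≤ 5 / 9 := by
        rw [hy, div_mul_eq_mul_div, div_le_iff₀ (by positivity)]
        linarith
      have : (1 - 14 / 9 + y * A) / T ≤ 0 := div_nonpos_of_nonpos_of_nonneg (by linarith) hT0.le
      linarith
    calc h * Q * R = c₁ * c₂ * ((W : ℝ) ^ (1 / T) * Q ^ (1 - (k - A) / T)) := by
          have eQ : Q ^ (1 - ((k : ℝ) - A) / T) = Q * Q ^ (-(((k : ℝ) - A) / T)) := by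
            rw [show 1 - ((k : ℝ) - A) / T = 1 + -(((k : ℝ) - A) / T) by ring,
              Real.rpow_add hQ0, Real.rpow_one]
          have eW : (W : ℝ) ^ (1 / T) = (W : ℝ) ^ (-(1 / T)) * (W : ℝ) ^ (2 / T) := by
            rw [← Real.rpow_add hW0]
            congr 1
            ring
          rw [hh, hR, eQ, eW]
          ring
      _ ≤ c₁ * c₂ * ((W : ℝ) ^ (1 / T) * (b₂ * (W : ℝ) ^ (y * (1 - (k - A) / T)))) := by
          gcongr; exact hQneg _ hs
      _ = c₁ * c₂ * b₂ * (W : ℝ) ^ (1 / T + y * (1 - (k - A) / T)) := by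
          rw [Real.rpow_add hW0]; ring
      _ ≤ _ := by gcongr
  refine hfin.trans ?_
  rw [mul_assoc (2 * ((A : ℝ) + 1)), mul_assoc (2 * ((A : ℝ) + 1))]
  refine mul_le_mul_of_nonneg_left ?_ (by positivity)
  calc (4 * (h * Q) + 1) * (2 / L + 1)
      ≤ (4 * (h * Q) + 1) * ((2 / c + 1) + 2 * R) := by gcongr
    _ = (4 * (h * Q) + 1) * (2 / c + 1) + 2 * (4 * (h * Q * R) + R) := by ring
    _ ≤ (4 * (4 * c₁ * (W : ℝ) ^ y) + (W : ℝ) ^ y) * (2 / c + 1)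
        + 2 * (4 * (c₁ * c₂ * b₂ * (W : ℝ) ^ y) + c₂ * b₁ * (W : ℝ) ^ y) := by gcongr
    _ = _ := by ring

open ArithmeticFunction in
lemma sum_divisors_moebius {m : ℕ} : ∑ d ∈ m.divisors, moebius d = if m = 1 then 1 else 0 := by
  rw [← coe_zeta_mul_apply, coe_zeta_mul_moebius, one_apply]

lemma kFree_iff_floorRoot_eq_one {k n : ℕ} :
    KFree k n ↔ Nat.floorRoot k n = 1 := by
  rw [Nat.eq_one_iff_not_exists_prime_dvd]
  simp only [KFree, Nat.pow_dvd_iff_dvd_floorRoot]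

open ArithmeticFunction in
open Classical in
lemma sum_moebius_of_pow_dvd {k n M : ℕ} (hk : k ≠ 0) (hn : n ≠ 0) (hM : n ≤ M) :
    ∑ d ∈ (Finset.Icc 1 M).filter (fun d => d ^ k ∣ n), moebius d
      = if KFree k n then 1 else 0 := by
  have h0 : Nat.floorRoot k n ≠ 0 := Nat.floorRoot_ne_zero.2 ⟨hk, hn⟩
  have : (Finset.Icc 1 M).filter (fun d => d ^ k ∣ n) = (Nat.floorRoot k n).divisors := by
    ext d
    simp only [Finset.mem_filter, Finset.mem_Icc, Nat.mem_divisors, Nat.pow_dvd_iff_dvd_floorRoot]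
    refine ⟨fun h => ⟨h.2, h0⟩, fun h => ⟨⟨Nat.pos_of_dvd_of_pos h.1 (Nat.pos_of_ne_zero h0), ?_⟩,
      h.1⟩⟩
    exact (Nat.le_self_pow hk d).trans
      ((Nat.le_of_dvd (Nat.pos_of_ne_zero hn) (Nat.pow_dvd_iff_dvd_floorRoot.2 h.1)).trans hM)
  rw [this, sum_divisors_moebius]
  simp only [kFree_iff_floorRoot_eq_one]

/-- The number of `n ≤ N` with `d ^ k ∣ n` and `e ^ k ∣ n + 1`. -/
def countDvd (k N d e : ℕ) : ℕ :=
  ((Finset.Icc 1 N).filter (fun n => d ^ k ∣ n ∧ e ^ k ∣ n + 1)).card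

lemma coprime_of_countDvd_ne_zero {k N d e : ℕ} (hk : k ≠ 0) (h : countDvd k N d e ≠ 0) :
    Nat.Coprime d e := by
  obtain ⟨n, hn⟩ := Finset.card_ne_zero.1 h
  obtain ⟨-, h1, h2⟩ := Finset.mem_filter.1 hn
  exact coprime_of_pow_dvd_succ hk h1 h2

open ArithmeticFunction in
lemma moebius_mul_moebius_mul_countDvd {k N d e : ℕ} (hk : k ≠ 0) :
    (moebius d : ℝ) * moebius e * countDvd k N d e = moebius (d * e) * countDvd k N d e := by
  by_cases h : countDvd k N d e = 0
  · simp [h]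
  · rw [isMultiplicative_moebius.map_mul_of_coprime (coprime_of_countDvd_ne_zero hk h)]
    push_cast
    rfl

open ArithmeticFunction in
lemma acount_eq_sum (k : ℕ) (hk : k ≠ 0) (Z : ℝ) :
    (Acount k Z : ℝ) = ∑ p ∈ Finset.Icc 1 (⌊Z⌋₊ + 1) ×ˢ Finset.Icc 1 (⌊Z⌋₊ + 1),
      (moebius (p.1 * p.2) : ℝ) * countDvd k ⌊Z⌋₊ p.1 p.2 := by
  classical
  set N := ⌊Z⌋₊ with hN
  set B := Finset.Icc 1 (N + 1) with hB
  have h1 : Acount k Z = ((Finset.Icc 1 N).filter (fun n => KFree k n ∧ KFree k (n + 1))).card := by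
    rw [Acount, ← Set.ncard_coe_finset]
    congr 1
    ext n
    simp only [Set.mem_ofPred_eq, Finset.coe_filter, Finset.mem_Icc]
    constructor
    · rintro ⟨h, h', h''⟩
      exact ⟨⟨h, Nat.le_floor h'⟩, h''⟩
    · rintro ⟨⟨h, h'⟩, h''⟩
      exact ⟨h, (Nat.le_floor_iff' (by omega)).1 h', h''⟩
  have h2 : ∀ n ∈ Finset.Icc 1 N, (if KFree k n ∧ KFree k (n + 1) then (1 : ℤ) else 0)
      = ∑ p ∈ B ×ˢ B, moebius p.1 * moebius p.2 *
        (if p.1 ^ k ∣ n ∧ p.2 ^ k ∣ n + 1 then 1 else 0) := by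
    intro n hn
    obtain ⟨hn1, hn2⟩ := Finset.mem_Icc.1 hn
    have e1 := sum_moebius_of_pow_dvd (M := N + 1) hk (by omega : n ≠ 0) (by omega)
    have e2 := sum_moebius_of_pow_dvd (M := N + 1) hk (by omega : n + 1 ≠ 0) (by omega)
    rw [← hB, Finset.sum_filter] at e1 e2
    have e3 : (if KFree k n ∧ KFree k (n + 1) then (1 : ℤ) else 0)
        = (if KFree k n then 1 else 0) * (if KFree k (n + 1) then 1 else 0) := by
      split_ifs <;> simp_all
    rw [e3, ← e1, ← e2, Finset.sum_mul_sum, ← Finset.sum_product']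
    refine Finset.sum_congr rfl fun p _ => ?_
    split_ifs <;> simp_all
  have h3 : (Acount k Z : ℤ) = ∑ p ∈ B ×ˢ B, moebius p.1 * moebius p.2 * countDvd k N p.1 p.2 := by
    rw [h1, Finset.card_filter]
    push_cast
    rw [Finset.sum_congr rfl h2, Finset.sum_comm]
    refine Finset.sum_congr rfl fun p _ => ?_
    rw [← Finset.mul_sum, countDvd, Finset.card_filter]
    push_cast
    rfl
  have h4 : (Acount k Z : ℝ) = ((Acount k Z : ℤ) : ℝ) := by simp
  rw [h4, h3]
  push_cast
  exact Finset.sum_congr rfl fun p _ => moebius_mul_moebius_mul_countDvd hk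

lemma abs_countDvd_sub_le {k N d e : ℕ} (hd : 0 < d) (he : 0 < e)
    (h : Nat.Coprime d e) : |(countDvd k N d e : ℝ) - N / ((d : ℝ) * e) ^ k| ≤ 1 := by
  have hc : Nat.Coprime (d ^ k) (e ^ k) := h.pow k k
  have hr : 0 < (d * e) ^ k := by positivity
  obtain ⟨v, hv1, hv2⟩ := Nat.chineseRemainder hc 0 (e ^ k - 1)
  have he1 : e ^ k - 1 + 1 = e ^ k := Nat.sub_add_cancel (Nat.one_le_pow _ _ he)
  have hiff : ∀ n, (d ^ k ∣ n ∧ e ^ k ∣ n + 1) ↔ n ≡ v [MOD (d * e) ^ k] := by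
    intro n
    rw [mul_pow, ← Nat.modEq_and_modEq_iff_modEq_mul hc]
    refine and_congr ?_ ?_
    · rw [← Nat.modEq_zero_iff_dvd]
      exact ⟨fun h => h.trans hv1.symm, fun h => h.trans hv1⟩
    · have : e ^ k ∣ n + 1 ↔ n ≡ e ^ k - 1 [MOD e ^ k] := by
        rw [← Nat.modEq_zero_iff_dvd]
        constructor
        · intro h
          refine Nat.ModEq.add_right_cancel' 1 (h.trans ?_)
          rw [he1]
          exact (Nat.modEq_zero_iff_dvd.2 dvd_rfl).symm
        · intro h
          refine (h.add_right 1).trans ?_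
          rw [he1]
          exact Nat.modEq_zero_iff_dvd.2 dvd_rfl
      rw [this]
      exact ⟨fun h => h.trans hv2.symm, fun h => h.trans hv2⟩
  have hcard : countDvd k N d e = ((Finset.Ioc 0 N).filter (· ≡ v [MOD (d * e) ^ k])).card := by
    rw [countDvd]
    simp only [hiff]
    rfl
  have hr' : (0 : ℚ) < ((d * e) ^ k : ℕ) := by exact_mod_cast hr
  have hq : |(countDvd k N d e : ℚ) - N / ((d * e) ^ k : ℕ)| ≤ 1 := by
    have hz := Nat.Ioc_filter_modEq_card 0 N hr v
    rw [← hcard, max_eq_left (by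
      rw [sub_nonneg]
      gcongr
      simp)] at hz
    have hz' : (countDvd k N d e : ℚ) = ⌊((N : ℚ) - v) / ((d * e) ^ k : ℕ)⌋
        - ⌊(((0 : ℕ) : ℚ) - v) / ((d * e) ^ k : ℕ)⌋ := by exact_mod_cast hz
    rw [hz']
    have e1 := Int.floor_le (((N : ℚ) - v) / ((d * e) ^ k : ℕ))
    have e2 := Int.lt_floor_add_one (((N : ℚ) - v) / ((d * e) ^ k : ℕ))
    have e3 := Int.floor_le ((((0 : ℕ) : ℚ) - v) / ((d * e) ^ k : ℕ))
    have e4 := Int.lt_floor_add_one ((((0 : ℕ) : ℚ) - v) / ((d * e) ^ k : ℕ))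
    have e5 : ((N : ℚ) - v) / ((d * e) ^ k : ℕ) - (((0 : ℕ) : ℚ) - v) / ((d * e) ^ k : ℕ)
        = N / ((d * e) ^ k : ℕ) := by
      push_cast
      ring
    rw [abs_le]
    constructor <;> linarith
  have := (Rat.cast_le (K := ℝ)).2 hq
  push_cast at this
  exact this

lemma hasSum_card_divisors_mul {F : ℕ → ℝ} (h0 : F 0 = 0)
    (hF : Summable fun p : ℕ × ℕ => F (p.1 * p.2)) :
    HasSum (fun m => (m.divisors.card : ℝ) * F m) (∑' p : ℕ × ℕ, F (p.1 * p.2)) := by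
  refine Eq.mp (congrArg (HasSum · _) (funext fun m => ?_))
    (hF.hasSum.tsum_fiberwise (fun p : ℕ × ℕ => p.1 * p.2))
  have h1 : ∀ b : ((fun p : ℕ × ℕ => p.1 * p.2) ⁻¹' {m} : Set (ℕ × ℕ)),
      F ((b : ℕ × ℕ).1 * (b : ℕ × ℕ).2) = F m := fun b => congrArg F b.2
  simp only [h1]
  rcases eq_or_ne m 0 with rfl | hm
  · simp [h0]
  · have hs : ((fun p : ℕ × ℕ => p.1 * p.2) ⁻¹' {m} : Set (ℕ × ℕ))
        = (m.divisorsAntidiagonal : Set (ℕ × ℕ)) := by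
      ext p
      simp [hm]
    rw [hs]
    simp [← Nat.map_div_right_divisors]

open ArithmeticFunction in
lemma ck_eq_tsum {k : ℕ}
    (hs : Summable fun p : ℕ × ℕ => (((p.1 : ℝ) * p.2) ^ k)⁻¹) :
    ck k = ∑' p : ℕ × ℕ, (moebius (p.1 * p.2) : ℝ) * (((p.1 : ℝ) * p.2) ^ k)⁻¹ := by
  set F : ℕ → ℝ := fun m => (moebius m : ℝ) * ((m : ℝ) ^ k)⁻¹ with hFdef
  have hF0 : F 0 = 0 := by simp [F]
  have hle : ∀ m, |F m| ≤ ((m : ℝ) ^ k)⁻¹ := by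
    intro m
    have : |(moebius m : ℝ)| ≤ 1 := by exact_mod_cast abs_moebius_le_one
    rw [hFdef, abs_mul, abs_of_nonneg (by positivity : (0 : ℝ) ≤ ((m : ℝ) ^ k)⁻¹)]
    exact mul_le_of_le_one_left (by positivity) this
  have hsA : Summable fun p : ℕ × ℕ => |F (p.1 * p.2)| :=
    hs.of_nonneg_of_le (fun _ => abs_nonneg _) fun p => by
      simpa using hle (p.1 * p.2)
  have hsum := hasSum_card_divisors_mul hF0 hsA.of_abs
  have hsum' := hasSum_card_divisors_mul (F := fun m => |F m|) (by simp [hF0]) hsA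
  have hprod := EulerProduct.eulerProduct_hasProd (f := fun m => (m.divisors.card : ℝ) * F m)
    (by simp [F]) (fun {m n} hmn => by
      simp only [F, hmn.card_divisors_mul, isMultiplicative_moebius.map_mul_of_coprime hmn]
      push_cast
      rw [mul_pow, mul_inv]
      ring)
    (by simpa [abs_mul] using hsum'.summable) (by simp)
  have h2 : ∀ p : Nat.Primes, ∑' e : ℕ, (((p : ℕ) ^ e).divisors.card : ℝ) * F ((p : ℕ) ^ e)
      = 1 - 2 / (p : ℝ) ^ k := by
    intro p
    rw [tsum_eq_sum (s := Finset.range 2)]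
    · simp [Finset.sum_range_succ, F, p.2.divisors, moebius_apply_prime p.2,
        Finset.card_pair p.2.one_lt.ne]
      ring
    · intro e he
      have : 2 ≤ e := by
        rw [Finset.mem_range] at he
        omega
      simp only [F]
      rw [moebius_apply_prime_pow p.2 (by omega), if_neg (by omega)]
      simp
  simp only [h2] at hprod
  rw [ck, hprod.tprod_eq, hsum.tsum_eq]
  simp [F]

/-- The number of pairs `(d, e)` with large product whose `k`-th powers divide two consecutive
integers up to `Z`. -/
lemma exists_card_pairs_le_log_mul_rpow (k : ℕ) (hk : 2 ≤ k) :
    ∃ C : ℝ, 0 < C ∧ ∀ (Z : ℝ) (P : Finset (ℕ × ℕ)), 1 ≤ Z →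
      (∀ p ∈ P, 0 < p.1 ∧ 0 < p.2 ∧ Z ^ (14 / (9 * (k : ℝ))) ≤ (p.1 : ℝ) * p.2 ∧
        ∃ n, 0 < n ∧ n ≤ ⌊Z⌋₊ ∧ p.1 ^ k ∣ n ∧ p.2 ^ k ∣ n + 1) →
      (P.card : ℝ) ≤
        C * ((Nat.log 2 (⌊Z⌋₊ + 1) + 1 : ℕ) : ℝ) ^ 3 * Z ^ (14 / (9 * (k : ℝ))) := by
  obtain ⟨C, hC, key⟩ := exists_card_pairs_le_rpow k hk
  refine ⟨C, hC, fun Z P hZ hP => ?_⟩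
  set y : ℝ := 14 / (9 * (k : ℝ)) with hy
  have hy0 : 0 ≤ y := by positivity
  have hex : ∀ p : ℕ × ℕ, ∃ n, p ∈ P → 0 < n ∧ n ≤ ⌊Z⌋₊ ∧ p.1 ^ k ∣ n ∧ p.2 ^ k ∣ n + 1 := by
    intro p
    by_cases hp : p ∈ P
    · obtain ⟨-, -, -, n, hn⟩ := hP p hp
      exact ⟨n, fun _ => hn⟩
    · exact ⟨0, fun h => absurd h hp⟩
  choose ν hν using hex
  set ℓ := Nat.log 2 (⌊Z⌋₊ + 1) + 1 with hℓ
  set g : ℕ × ℕ → ℕ × ℕ × ℕ := fun p => (Nat.log 2 p.1, Nat.log 2 p.2, Nat.log 2 (ν p)) with hg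
  have hlog : ∀ a, a ≤ ⌊Z⌋₊ + 1 → Nat.log 2 a ∈ Finset.range ℓ := fun a ha =>
    Finset.mem_range.2 (Nat.lt_succ_of_le (Nat.log_mono_right ha))
  have hmaps : Set.MapsTo g P
      (Finset.range ℓ ×ˢ (Finset.range ℓ ×ˢ Finset.range ℓ) : Finset (ℕ × ℕ × ℕ)) := by
    intro p hp
    obtain ⟨h1, h2, h3, h4⟩ := hν p hp
    have hd : p.1 ≤ ⌊Z⌋₊ + 1 := (Nat.le_self_pow (by omega) p.1).trans
      ((Nat.le_of_dvd h1 h3).trans (by omega))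
    have he : p.2 ≤ ⌊Z⌋₊ + 1 := (Nat.le_self_pow (by omega) p.2).trans
      ((Nat.le_of_dvd (by omega) h4).trans (by omega))
    simp only [Finset.coe_product, Set.mem_prod, hg]
    exact ⟨hlog _ hd, hlog _ he, hlog _ (by omega)⟩
  rw [Finset.card_eq_sum_card_fiberwise hmaps]
  push_cast
  have hfib : ∀ b ∈ Finset.range ℓ ×ˢ (Finset.range ℓ ×ˢ Finset.range ℓ),
      ((P.filter (fun p => g p = b)).card : ℝ) ≤ C * Z ^ y := by
    rintro ⟨i, j, w⟩ -
    rcases (P.filter (fun p => g p = (i, j, w))).eq_empty_or_nonempty with h0 | ⟨q, hq⟩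
    · rw [h0]
      simp only [Finset.card_empty, Nat.cast_zero]
      positivity
    · have hbox : ∀ a m : ℕ, a ≠ 0 → Nat.log 2 a = m → 2 ^ m ≤ a ∧ a < 2 * 2 ^ m := by
        rintro a m ha rfl
        refine ⟨Nat.pow_log_le_self 2 ha, ?_⟩
        rw [← pow_succ']
        exact Nat.lt_pow_succ_log_self one_lt_two a
      have hall : ∀ p ∈ P.filter (fun p => g p = (i, j, w)),
          (2 ^ i ≤ p.1 ∧ p.1 < 2 * 2 ^ i) ∧ (2 ^ j ≤ p.2 ∧ p.2 < 2 * 2 ^ j) ∧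
            2 ^ w ≤ ν p ∧ ν p < 2 * 2 ^ w := by
        intro p hp
        obtain ⟨hpP, hpg⟩ := Finset.mem_filter.1 hp
        simp only [hg, Prod.mk.injEq] at hpg
        obtain ⟨h1, h2, -⟩ := hP p hpP
        exact ⟨hbox _ _ h1.ne' hpg.1, hbox _ _ h2.ne' hpg.2.1,
          hbox _ _ (hν p hpP).1.ne' hpg.2.2⟩
      obtain ⟨⟨-, q1⟩, ⟨-, q2⟩, q3, -⟩ := hall q hq
      have hqP := (Finset.mem_filter.1 hq).1
      have hWZ : ((2 ^ w : ℕ) : ℝ) ≤ Z :=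
        (Nat.cast_le.2 (q3.trans (hν q hqP).2.1)).trans (Nat.floor_le (by linarith))
      have hWy : ((2 ^ w : ℕ) : ℝ) ^ y ≤ Z ^ y := Real.rpow_le_rpow (by positivity) hWZ hy0
      refine (key (2 ^ i) (2 ^ j) (2 ^ w) _ (by positivity) (by positivity) (by positivity)
        (fun p hp => ?_) (hWy.trans ((hP q hqP).2.2.1.trans ?_))).trans
        (mul_le_mul_of_nonneg_left hWy hC.le)
      · obtain ⟨a1, a2, a3, a4⟩ := hall p hp
        obtain ⟨b1, b2, b3⟩ := hν p (Finset.mem_filter.1 hp).1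
        exact ⟨a1, a2, ν p, a3, a4, b3⟩
      · have q1' : (q.1 : ℝ) ≤ 2 * (2 ^ i : ℕ) := by exact_mod_cast q1.le
        have q2' : (q.2 : ℝ) ≤ 2 * (2 ^ j : ℕ) := by exact_mod_cast q2.le
        calc (q.1 : ℝ) * q.2 ≤ (2 * (2 ^ i : ℕ)) * (2 * (2 ^ j : ℕ)) := by gcongr
          _ = _ := by ring
  refine (Finset.sum_le_card_nsmul _ _ _ hfib).trans (le_of_eq ?_)
  simp only [Finset.card_product, Finset.card_range, nsmul_eq_mul]
  push_cast
  ring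

lemma exists_log_cube_le_rpow {ε : ℝ} (hε : 0 < ε) :
    ∃ C : ℝ, 0 < C ∧ ∀ Z : ℝ, 1 ≤ Z →
      ((Nat.log 2 (⌊Z⌋₊ + 1) + 1 : ℕ) : ℝ) ^ 3 ≤ C * Z ^ ε := by
  set δ := ε / 3 with hδ
  have hδ0 : 0 < δ := by positivity
  refine ⟨(2 * (2 ^ δ / δ) + 1) ^ 3, by positivity, fun Z hZ => ?_⟩
  have hZ0 : 0 ≤ Z := by linarith
  have hN : ((⌊Z⌋₊ + 1 : ℕ) : ℝ) ≤ 2 * Z := by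
    push_cast
    linarith [Nat.floor_le hZ0]
  set m := Nat.log 2 (⌊Z⌋₊ + 1) with hm
  have h1 : (2 : ℝ) ^ m ≤ 2 * Z := by
    refine le_trans ?_ hN
    exact_mod_cast Nat.pow_log_le_self 2 (by omega : ⌊Z⌋₊ + 1 ≠ 0)
  have h2 : m * Real.log 2 ≤ (2 * Z) ^ δ / δ := by
    rw [← Real.log_pow]
    exact (Real.log_le_log (by positivity) h1).trans
      (Real.log_le_rpow_div (by positivity) hδ0)
  have h3 : (m : ℝ) / 2 ≤ m * Real.log 2 := by
    rw [div_eq_mul_inv]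
    gcongr
    linarith [Real.log_two_gt_d9]
  have h4 : (m : ℝ) ≤ 2 * (2 ^ δ / δ) * Z ^ δ := by
    rw [Real.mul_rpow (by norm_num) hZ0] at h2
    have : 2 * (2 ^ δ / δ) * Z ^ δ = 2 * ((2 : ℝ) ^ δ * Z ^ δ / δ) := by ring
    linarith
  have h5 : 1 ≤ Z ^ δ := Real.one_le_rpow hZ hδ0.le
  have h6 : Z ^ ε = (Z ^ δ) ^ 3 := by
    rw [← Real.rpow_mul_natCast hZ0, hδ]
    congr 1
    push_cast
    ring
  rw [h6, ← mul_pow]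
  gcongr
  push_cast
  linarith

lemma summable_rpow_mul {s : ℝ} (hs : s < -1) :
    Summable fun p : ℕ × ℕ => ((p.1 : ℝ) * p.2) ^ s := by
  have h := (Real.summable_nat_rpow.2 hs).mul_of_nonneg (Real.summable_nat_rpow.2 hs)
    (fun n => by positivity) (fun n => by positivity)
  exact h.congr fun p => (Real.mul_rpow (by positivity) (by positivity)).symm

lemma card_le_rpow_mul_tsum {s Y : ℝ} (hs : 1 < s) {S : Finset (ℕ × ℕ)}
    (hS : ∀ p ∈ S, 0 < (p.1 : ℝ) * p.2 ∧ (p.1 : ℝ) * p.2 ≤ Y) (hY : 0 < Y) :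
    (S.card : ℝ) ≤ Y ^ s * ∑' p : ℕ × ℕ, ((p.1 : ℝ) * p.2) ^ (-s) := by
  calc (S.card : ℝ) = ∑ p ∈ S, (1 : ℝ) := by simp
    _ ≤ ∑ p ∈ S, Y ^ s * ((p.1 : ℝ) * p.2) ^ (-s) := by
      refine Finset.sum_le_sum fun p hp => ?_
      obtain ⟨h1, h2⟩ := hS p hp
      rw [Real.rpow_neg h1.le, ← div_eq_mul_inv, one_le_div (by positivity)]
      gcongr
    _ = Y ^ s * ∑ p ∈ S, ((p.1 : ℝ) * p.2) ^ (-s) := by rw [Finset.mul_sum]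
    _ ≤ _ := by
      gcongr
      exact (summable_rpow_mul (by linarith)).sum_le_tsum _ fun p _ => by positivity

lemma abs_tsum_sub_sum_le {s t Y : ℝ} (hs : 1 < s) (hst : s ≤ t) (hY : 0 < Y)
    {f : ℕ × ℕ → ℝ} (hf : ∀ p, |f p| ≤ ((p.1 : ℝ) * p.2) ^ (-t)) {S : Finset (ℕ × ℕ)}
    (hS : ∀ p ∉ S, f p ≠ 0 → Y ≤ (p.1 : ℝ) * p.2) :
    |∑' p, f p - ∑ p ∈ S, f p| ≤ Y ^ (s - t) * ∑' p : ℕ × ℕ, ((p.1 : ℝ) * p.2) ^ (-s) := by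
  have hsumf : Summable f :=
    ((summable_rpow_mul (by linarith)).of_nonneg_of_le (fun _ => abs_nonneg _) hf).of_abs
  have hout : ∀ p : ℕ × ℕ, p ∉ S → ‖f p‖ ≤ Y ^ (s - t) * ((p.1 : ℝ) * p.2) ^ (-s) := by
    intro p hp
    rcases eq_or_ne (f p) 0 with h0 | h0
    · rw [h0, norm_zero]
      positivity
    · have hYp := hS p hp h0
      refine (hf p).trans ?_
      rw [show -t = (s - t) + -s by ring, Real.rpow_add (hY.trans_le hYp)]
      gcongr ?_ * _
      exact Real.rpow_le_rpow_of_nonpos hY hYp (by linarith)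
  have hs1 : Summable fun p : ((S : Set (ℕ × ℕ))ᶜ : Set (ℕ × ℕ)) => ‖f p‖ :=
    hsumf.norm.subtype _
  have hs2 := (summable_rpow_mul (s := -s) (by linarith)).mul_left (Y ^ (s - t))
  rw [← hsumf.sum_add_tsum_compl (s := S), add_sub_cancel_left, ← Real.norm_eq_abs]
  refine (norm_tsum_le_tsum_norm hs1).trans ?_
  refine (hs1.tsum_le_tsum (g := fun p : ((S : Set (ℕ × ℕ))ᶜ : Set (ℕ × ℕ)) =>
    Y ^ (s - t) * (((p : ℕ × ℕ).1 : ℝ) * (p : ℕ × ℕ).2) ^ (-s))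
    (fun p => hout p p.2) (hs2.subtype _)).trans ?_
  rw [← tsum_mul_left]
  exact hs2.tsum_subtype_le (fun p : ℕ × ℕ => Y ^ (s - t) * ((p.1 : ℝ) * p.2) ^ (-s)) _
    fun p => by positivity

lemma abs_countDvd_floor_sub_le {k d e : ℕ} {Z : ℝ} (hZ : 0 ≤ Z) (hd : 0 < d) (he : 0 < e)
    (h : Nat.Coprime d e) :
    |(countDvd k ⌊Z⌋₊ d e : ℝ) - Z * (((d : ℝ) * e) ^ k)⁻¹| ≤ 2 := by
  have h1 := Nat.floor_le hZ
  have h2 := Nat.lt_floor_add_one Z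
  have h3 := abs_le.1 (abs_countDvd_sub_le (k := k) (N := ⌊Z⌋₊) hd he h)
  have hd' : (1 : ℝ) ≤ d := by exact_mod_cast hd
  have he' : (1 : ℝ) ≤ e := by exact_mod_cast he
  have h4 : (((d : ℝ) * e) ^ k)⁻¹ ≤ 1 := inv_le_one_of_one_le₀ (one_le_pow₀ (by nlinarith))
  have h5 : 0 ≤ (((d : ℝ) * e) ^ k)⁻¹ := by positivity
  rw [div_eq_mul_inv] at h3
  rw [abs_le]
  constructor <;> nlinarith

open ArithmeticFunction in
theorem stmt_0 (k : ℕ) (hk : 2 ≤ k) (ε : ℝ) (hε : 0 < ε) :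
    ∃ C : ℝ, 0 < C ∧ ∀ Z : ℝ, 1 ≤ Z →
      |(Acount k Z : ℝ) - ck k * Z| ≤ C * Z ^ (14 / (9 * (k : ℝ)) + ε) := by
  have hk' : (2 : ℝ) ≤ k := by exact_mod_cast hk
  have hk0 : k ≠ 0 := by omega
  set y : ℝ := 14 / (9 * (k : ℝ)) with hy
  have hy0 : 0 < y := by positivity
  have hyk : y * k = 14 / 9 := by rw [hy]; field_simp
  have hy1 : y ≤ 1 := by
    rw [hy, div_le_one (by positivity)]
    linarith
  set η : ℝ := min 1 ε with hη
  have hη0 : 0 < η := by positivity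
  have hη1 : η ≤ 1 := min_le_left _ _
  have hηε : η ≤ ε := min_le_right _ _
  set B : ℝ := ∑' p : ℕ × ℕ, ((p.1 : ℝ) * p.2) ^ (-(1 + η)) with hB
  have hB0 : 0 ≤ B := tsum_nonneg fun p => by positivity
  have hsumk : Summable fun p : ℕ × ℕ => (((p.1 : ℝ) * p.2) ^ k)⁻¹ := by
    refine (summable_rpow_mul (s := -k) (by linarith)).congr fun p => ?_
    rw [Real.rpow_neg (by positivity), Real.rpow_natCast]
  set f : ℕ × ℕ → ℝ := fun p => (moebius (p.1 * p.2) : ℝ) * (((p.1 : ℝ) * p.2) ^ k)⁻¹ with hf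
  have hμ : ∀ m, |(moebius m : ℝ)| ≤ 1 := fun m => by exact_mod_cast abs_moebius_le_one
  have hfle : ∀ p, |f p| ≤ (((p.1 : ℝ) * p.2) ^ k)⁻¹ := by
    intro p
    rw [hf, abs_mul, abs_of_nonneg (by positivity : (0 : ℝ) ≤ (((p.1 : ℝ) * p.2) ^ k)⁻¹)]
    exact mul_le_of_le_one_left (by positivity) (hμ _)
  have hck : ck k = ∑' p, f p := ck_eq_tsum hsumk
  obtain ⟨C₁, hC₁, hpairs⟩ := exists_card_pairs_le_log_mul_rpow k hk
  obtain ⟨C₂, hC₂, hlog⟩ := exists_log_cube_le_rpow hε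
  refine ⟨3 * B + 3 * (C₁ * C₂), by positivity, fun Z hZ => ?_⟩
  have hZ0 : 0 < Z := by linarith
  set Y : ℝ := Z ^ y with hY
  have hY0 : 0 < Y := by positivity
  have hYk : Z ≤ Y ^ k := by
    rw [hY, ← Real.rpow_mul_natCast hZ0.le, hyk]
    exact Real.self_le_rpow_of_one_le hZ (by norm_num)
  have hYZ : Y ≤ Z := Real.rpow_le_self_of_one_le hZ hy1
  have hYη : Y ^ (1 + η) ≤ Z ^ (y + ε) := by
    rw [hY, ← Real.rpow_mul hZ0.le]
    refine Real.rpow_le_rpow_of_exponent_le hZ ?_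
    nlinarith
  set N := ⌊Z⌋₊ with hN
  have hZN : Z < N + 1 := Nat.lt_floor_add_one Z
  set box := Finset.Icc 1 (N + 1) ×ˢ Finset.Icc 1 (N + 1) with hbox
  have hboxpos : ∀ p ∈ box, 0 < p.1 ∧ 0 < p.2 := by
    intro p hp
    simp only [hbox, Finset.mem_product, Finset.mem_Icc] at hp
    omega
  set S := box.filter (fun p => (p.1 : ℝ) * p.2 ≤ Y) with hS
  have hScard : (S.card : ℝ) ≤ Y ^ (1 + η) * B :=
    card_le_rpow_mul_tsum (by linarith) (fun p hp => by
      obtain ⟨hp1, hp2⟩ := Finset.mem_filter.1 hp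
      obtain ⟨h1, h2⟩ := hboxpos p hp1
      exact ⟨by positivity, hp2⟩) hY0
  have htail : |ck k - ∑ p ∈ S, f p| ≤ Y ^ (1 + η - k) * B := by
    rw [hck]
    refine abs_tsum_sub_sum_le (by linarith) (by linarith) hY0 (fun p => ?_) fun p hp h0 => ?_
    · rw [Real.rpow_neg (by positivity), Real.rpow_natCast]
      exact hfle p
    · have h1 : p.1 * p.2 ≠ 0 := fun h => h0 (by simp [hf, h])
      by_contra! hlt
      have h1' : (1 : ℝ) ≤ p.1 := by
        exact_mod_cast Nat.one_le_iff_ne_zero.2 (left_ne_zero_of_mul h1)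
      have h2' : (1 : ℝ) ≤ p.2 := by
        exact_mod_cast Nat.one_le_iff_ne_zero.2 (right_ne_zero_of_mul h1)
      have h4 : (p.1 : ℝ) < (N + 1 : ℕ) := by push_cast; nlinarith
      have h5 : (p.2 : ℝ) < (N + 1 : ℕ) := by push_cast; nlinarith
      rw [Nat.cast_lt] at h4 h5
      rw [Nat.one_le_cast] at h1' h2'
      refine hp (Finset.mem_filter.2 ⟨?_, hlt.le⟩)
      simp only [hbox, Finset.mem_product, Finset.mem_Icc]
      omega
  have htailZ : |ck k - ∑ p ∈ S, f p| * Z ≤ Y ^ (1 + η) * B := by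
    calc |ck k - ∑ p ∈ S, f p| * Z ≤ Y ^ (1 + η - k) * B * Y ^ k := by gcongr
      _ = Y ^ (1 + η) * B := by
        rw [Real.rpow_sub hY0, Real.rpow_natCast]
        field_simp
  have hdiff : ∀ p ∈ box, Nat.Coprime p.1 p.2 →
      |(countDvd k N p.1 p.2 : ℝ) - Z * (((p.1 : ℝ) * p.2) ^ k)⁻¹| ≤ 2 := fun p hp hc =>
    abs_countDvd_floor_sub_le hZ0.le (hboxpos p hp).1 (hboxpos p hp).2 hc
  have hsmall : |∑ p ∈ S, (moebius (p.1 * p.2) : ℝ) * countDvd k N p.1 p.2 - Z * ∑ p ∈ S, f p|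
      ≤ 2 * (Y ^ (1 + η) * B) := by
    rw [Finset.mul_sum, ← Finset.sum_sub_distrib]
    refine (Finset.abs_sum_le_sum_abs _ _).trans ?_
    have : ∀ p ∈ S, |(moebius (p.1 * p.2) : ℝ) * countDvd k N p.1 p.2 - Z * f p| ≤ 2 := by
      intro p hp
      have hpb := (Finset.mem_filter.1 hp).1
      have e : (moebius (p.1 * p.2) : ℝ) * countDvd k N p.1 p.2 - Z * f p
          = moebius (p.1 * p.2) * (countDvd k N p.1 p.2 - Z * (((p.1 : ℝ) * p.2) ^ k)⁻¹) := by
        rw [hf]; ring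
      rw [e, abs_mul]
      by_cases hc : Nat.Coprime p.1 p.2
      · exact (mul_le_of_le_one_left (abs_nonneg _) (hμ _)).trans (hdiff p hpb hc)
      · rw [moebius_eq_zero_of_not_squarefree fun h => hc (Nat.coprime_of_squarefree_mul h)]
        simp
    refine (Finset.sum_le_card_nsmul _ _ _ this).trans ?_
    rw [nsmul_eq_mul]
    linarith
  set P := (box.filter (fun p => ¬ (p.1 : ℝ) * p.2 ≤ Y)).filter
    (fun p => countDvd k N p.1 p.2 ≠ 0) with hP
  have hPcard : (P.card : ℝ) ≤ C₁ * C₂ * Z ^ (y + ε) := by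
    refine (hpairs Z P hZ fun p hp => ?_).trans ?_
    · obtain ⟨hp1, hp2⟩ := Finset.mem_filter.1 hp
      obtain ⟨hp3, hp4⟩ := Finset.mem_filter.1 hp1
      obtain ⟨h1, h2⟩ := hboxpos p hp3
      obtain ⟨n, hn⟩ := Finset.card_ne_zero.1 hp2
      obtain ⟨hn1, hn2⟩ := Finset.mem_filter.1 hn
      obtain ⟨hn3, hn4⟩ := Finset.mem_Icc.1 hn1
      exact ⟨h1, h2, (not_le.1 hp4).le, n, hn3, hn4, hn2⟩
    · rw [Real.rpow_add hZ0]
      calc _ ≤ C₁ * (C₂ * Z ^ ε) * Z ^ y := by gcongr; exact hlog Z hZ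
        _ = _ := by ring
  have hlarge : |∑ p ∈ box.filter (fun p => ¬ (p.1 : ℝ) * p.2 ≤ Y),
      (moebius (p.1 * p.2) : ℝ) * countDvd k N p.1 p.2| ≤ 3 * (C₁ * C₂ * Z ^ (y + ε)) := by
    refine (Finset.abs_sum_le_sum_abs _ _).trans ?_
    rw [← Finset.sum_filter_of_ne (p := fun p => countDvd k N p.1 p.2 ≠ 0)
      (fun p _ h h' => h (by rw [h']; simp))]
    have : ∀ p ∈ P, |(moebius (p.1 * p.2) : ℝ) * countDvd k N p.1 p.2| ≤ 3 := by
      intro p hp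
      obtain ⟨hp1, hp2⟩ := Finset.mem_filter.1 hp
      obtain ⟨hp3, hp4⟩ := Finset.mem_filter.1 hp1
      have h := (abs_le.1 (hdiff p hp3 (coprime_of_countDvd_ne_zero hk0 hp2))).2
      have h1 : Z * (((p.1 : ℝ) * p.2) ^ k)⁻¹ ≤ 1 := by
        have hYp := (not_le.1 hp4).le
        rw [← div_eq_mul_inv]
        refine div_le_one_of_le₀ (hYk.trans ?_) (by positivity)
        gcongr
      rw [abs_mul, abs_of_nonneg (Nat.cast_nonneg (α := ℝ) (countDvd k N p.1 p.2))]
      exact (mul_le_of_le_one_left (Nat.cast_nonneg _) (hμ _)).trans (by linarith)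
    refine (Finset.sum_le_card_nsmul _ _ _ this).trans ?_
    rw [nsmul_eq_mul]
    linarith
  rw [acount_eq_sum k hk0 Z, ← Finset.sum_filter_add_sum_filter_not box
    (fun p => (p.1 : ℝ) * p.2 ≤ Y)]
  set U := ∑ p ∈ S, (moebius (p.1 * p.2) : ℝ) * countDvd k N p.1 p.2
  set V := ∑ p ∈ box.filter (fun p => ¬ (p.1 : ℝ) * p.2 ≤ Y),
    (moebius (p.1 * p.2) : ℝ) * countDvd k N p.1 p.2
  have htailZ' : |(ck k - ∑ p ∈ S, f p) * Z| ≤ Y ^ (1 + η) * B := by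
    rwa [abs_mul, abs_of_pos hZ0]
  have hBY : Y ^ (1 + η) * B ≤ B * Z ^ (y + ε) := by
    rw [mul_comm]
    gcongr
  rw [abs_le] at hsmall hlarge htailZ' ⊢
  constructor <;> linarith
end

section
/- Let k ≥ 2 be an integer and ε > 0. Then there exists a constant C = C(k,ε) > 0 such that for all real P ≥ 1 one has |∑ μ(x)·μ(y)/(x·y)^k − c_k| ≤ C·P^{1−k+ε}, where the sum is over all pairs of positive integers (x,y) with x·y ≤ P and gcd(x,y) = 1. -/
open ArithmeticFunction in
lemma summable_card_divisors_div_rpow {s : ℝ} (hs : 1 < s) :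
    Summable fun n : ℕ => (n.divisors.card : ℝ) / (n : ℝ) ^ s := by
  have hζ : LSeriesSummable (fun n => (zeta : ArithmeticFunction ℂ) n) (s : ℂ) :=
    LSeriesSummable_zeta_iff.mpr (by simpa using hs)
  refine (LSeriesSummable_mul hζ hζ).norm.congr fun n => ?_
  rcases eq_or_ne n 0 with rfl | hn
  · simp
  · have hcard : ((zeta : ArithmeticFunction ℂ) * (zeta : ArithmeticFunction ℂ)) n =
        (n.divisors.card : ℂ) := by
      rw [coe_zeta_mul_apply, Finset.sum_congr rfl (g := fun _ => (1 : ℂ))]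
      · simp
      · intro i hi
        simp [(Nat.pos_of_mem_divisors hi).ne']
    rw [LSeries.norm_term_eq, if_neg hn, Complex.ofReal_re, hcard, Complex.norm_natCast]

/-- The `n`-th term `μ(n) d(n) / n ^ k` of the Dirichlet series of `∏ p, (1 - 2 / p ^ k)`. -/
noncomputable def moebiusDivisorTerm (k n : ℕ) : ℝ :=
  (ArithmeticFunction.moebius n : ℝ) * (n.divisors.card : ℝ) / (n : ℝ) ^ k

lemma abs_moebiusDivisorTerm_le (k n : ℕ) :
    |moebiusDivisorTerm k n| ≤ (n.divisors.card : ℝ) / (n : ℝ) ^ k := by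
  have hμ : |(ArithmeticFunction.moebius n : ℝ)| ≤ 1 := by
    exact_mod_cast ArithmeticFunction.abs_moebius_le_one (n := n)
  rw [moebiusDivisorTerm, abs_div, abs_mul, Nat.abs_cast,
    abs_of_nonneg (by positivity : (0 : ℝ) ≤ (n : ℝ) ^ k)]
  gcongr
  exact mul_le_of_le_one_left (by positivity) hμ

lemma summable_abs_moebiusDivisorTerm {k : ℕ} (hk : 2 ≤ k) :
    Summable fun n => |moebiusDivisorTerm k n| := by
  have hk' : (1 : ℝ) < (k : ℝ) := by exact_mod_cast hk
  refine (summable_card_divisors_div_rpow hk').of_nonneg_of_le (fun _ => abs_nonneg _) fun n => ?_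
  simpa using abs_moebiusDivisorTerm_le k n

lemma moebiusDivisorTerm_mul (k : ℕ) {m n : ℕ} (h : m.Coprime n) :
    moebiusDivisorTerm k (m * n) = moebiusDivisorTerm k m * moebiusDivisorTerm k n := by
  simp only [moebiusDivisorTerm, h.card_divisors_mul,
    ArithmeticFunction.isMultiplicative_moebius.map_mul_of_coprime h]
  push_cast
  rw [mul_pow, div_mul_div_comm]
  ring

lemma tsum_moebiusDivisorTerm_prime_pow (k : ℕ) {p : ℕ} (hp : p.Prime) :
    ∑' e : ℕ, moebiusDivisorTerm k (p ^ e) = 1 - 2 / (p : ℝ) ^ k := by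
  rw [tsum_eq_sum (s := Finset.range 2)]
  · simp [Finset.sum_range_succ, moebiusDivisorTerm, ArithmeticFunction.moebius_apply_prime hp,
      hp.divisors, Finset.card_pair hp.one_lt.ne]
    ring
  · intro e he
    rw [Finset.mem_range, not_lt] at he
    rw [moebiusDivisorTerm, ArithmeticFunction.moebius_apply_prime_pow hp (by lia),
      if_neg (by lia)]
    simp

lemma tsum_moebiusDivisorTerm {k : ℕ} (hk : 2 ≤ k) : ∑' n, moebiusDivisorTerm k n = ck k := by
  rw [ck, ← EulerProduct.eulerProduct_tprod (f := moebiusDivisorTerm k)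
    (by simp [moebiusDivisorTerm]) (moebiusDivisorTerm_mul k)
    (summable_abs_moebiusDivisorTerm hk) (by simp [moebiusDivisorTerm])]
  exact tprod_congr fun p => tsum_moebiusDivisorTerm_prime_pow k p.2

open ArithmeticFunction in
lemma sum_divisorsAntidiagonal_coprime_moebius (k n : ℕ) :
    ∑ p ∈ n.divisorsAntidiagonal with Nat.Coprime p.1 p.2,
      (moebius p.1 : ℝ) * (moebius p.2 : ℝ) / ((p.1 * p.2 : ℕ) : ℝ) ^ k =
      moebiusDivisorTerm k n := by
  have hterm : ∀ p ∈ n.divisorsAntidiagonal.filter (fun p => Nat.Coprime p.1 p.2),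
      (moebius p.1 : ℝ) * (moebius p.2 : ℝ) / ((p.1 * p.2 : ℕ) : ℝ) ^ k =
        (moebius n : ℝ) / (n : ℝ) ^ k := by
    intro p hp
    rw [Finset.mem_filter, Nat.mem_divisorsAntidiagonal] at hp
    obtain ⟨⟨rfl, -⟩, hc⟩ := hp
    rw [isMultiplicative_moebius.map_mul_of_coprime hc, Int.cast_mul]
  rw [Finset.sum_congr rfl hterm, Finset.sum_const, nsmul_eq_mul, moebiusDivisorTerm]
  by_cases hn : Squarefree n
  · rw [Finset.filter_true_of_mem, ← Nat.map_div_right_divisors, Finset.card_map]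
    · ring
    · intro p hp
      rw [Nat.mem_divisorsAntidiagonal] at hp
      exact Nat.coprime_of_squarefree_mul (hp.1 ▸ hn)
  · simp [moebius_eq_zero_of_not_squarefree hn]

open ArithmeticFunction in
lemma sum_coprime_pairs_eq_sum_range (k : ℕ) {P : ℝ} (hP : 0 ≤ P) :
    ∑ p ∈ (Finset.Icc 1 ⌊P⌋₊ ×ˢ Finset.Icc 1 ⌊P⌋₊).filter
        (fun p : ℕ × ℕ => (p.1 * p.2 : ℝ) ≤ P ∧ Nat.Coprime p.1 p.2),
      (moebius p.1 : ℝ) * (moebius p.2 : ℝ) / ((p.1 * p.2 : ℕ) : ℝ) ^ k =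
      ∑ n ∈ Finset.range (⌊P⌋₊ + 1), moebiusDivisorTerm k n := by
  rw [← Finset.sum_fiberwise_of_maps_to (g := fun p : ℕ × ℕ => p.1 * p.2)
    (t := Finset.range (⌊P⌋₊ + 1))]
  · refine Finset.sum_congr rfl fun n hn => ?_
    rw [← sum_divisorsAntidiagonal_coprime_moebius]
    refine Finset.sum_congr ?_ fun _ _ => rfl
    ext ⟨a, b⟩
    simp only [Finset.mem_filter, Finset.mem_product, Finset.mem_Icc,
      Nat.mem_divisorsAntidiagonal, Finset.mem_range, Nat.lt_succ_iff] at hn ⊢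
    constructor
    · rintro ⟨⟨⟨⟨ha, -⟩, hb, -⟩, -, hc⟩, rfl⟩
      exact ⟨⟨rfl, by positivity⟩, hc⟩
    · rintro ⟨⟨rfl, h0⟩, hc⟩
      have ha : 0 < a := Nat.pos_of_ne_zero (left_ne_zero_of_mul h0)
      have hb : 0 < b := Nat.pos_of_ne_zero (right_ne_zero_of_mul h0)
      exact ⟨⟨⟨⟨ha, (Nat.le_mul_of_pos_right a hb).trans hn⟩, hb,
        (Nat.le_mul_of_pos_left b ha).trans hn⟩,
        by exact_mod_cast (Nat.le_floor_iff hP).mp hn, hc⟩, rfl⟩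
  · intro p hp
    rw [Finset.mem_filter] at hp
    rw [Finset.mem_range, Nat.lt_succ_iff, Nat.le_floor_iff hP]
    exact_mod_cast hp.2.1

lemma abs_moebiusDivisorTerm_le_rpow_mul {k n : ℕ} {P δ : ℝ} (hP : 0 < P) (hn : P ≤ n)
    (hδ : δ ≤ k - 1) :
    |moebiusDivisorTerm k n| ≤
      P ^ (1 - (k : ℝ) + δ) * ((n.divisors.card : ℝ) / (n : ℝ) ^ (1 + δ)) := by
  have hn0 : (0 : ℝ) < n := hP.trans_le hn
  calc |moebiusDivisorTerm k n| ≤ (n.divisors.card : ℝ) / (n : ℝ) ^ k :=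
        abs_moebiusDivisorTerm_le k n
    _ = (n : ℝ) ^ (1 - (k : ℝ) + δ) * ((n.divisors.card : ℝ) / (n : ℝ) ^ (1 + δ)) := by
        have h : (n : ℝ) ^ (1 - (k : ℝ) + δ) = (n : ℝ) ^ (1 + δ) / (n : ℝ) ^ k := by
          rw [← Real.rpow_natCast, ← Real.rpow_sub hn0]
          ring_nf
        rw [h]
        field_simp
    _ ≤ _ := by
        gcongr ?_ * _
        exact Real.rpow_le_rpow_of_nonpos hP hn (by linarith)

theorem stmt_4 (k : ℕ) (hk : 2 ≤ k) (ε : ℝ) (hε : 0 < ε) :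
    ∃ C : ℝ, 0 < C ∧ ∀ P : ℝ, 1 ≤ P →
      |(∑ p ∈ (Finset.Icc 1 ⌊P⌋₊ ×ˢ Finset.Icc 1 ⌊P⌋₊).filter
            (fun p : ℕ × ℕ => (p.1 * p.2 : ℝ) ≤ P ∧ Nat.Coprime p.1 p.2),
          (ArithmeticFunction.moebius p.1 : ℝ) * (ArithmeticFunction.moebius p.2 : ℝ)
            / ((p.1 * p.2 : ℕ) : ℝ) ^ k) - ck k|
        ≤ C * P ^ (1 - (k : ℝ) + ε) := by
  set δ : ℝ := min ε 1
  have hδ : 0 < δ := lt_min hε one_pos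
  have hk' : (2 : ℝ) ≤ k := by exact_mod_cast hk
  have hδk : δ ≤ k - 1 := (min_le_right _ _).trans (by linarith)
  set h : ℕ → ℝ := fun n => (n.divisors.card : ℝ) / (n : ℝ) ^ (1 + δ)
  have hh : Summable h := summable_card_divisors_div_rpow (by linarith)
  have hh0 : ∀ n, 0 ≤ h n := fun n => by positivity
  refine ⟨∑' n, h n + 1, by positivity, fun P hP => ?_⟩
  have hP0 : 0 < P := by linarith
  have hsum := summable_abs_moebiusDivisorTerm hk
  set N := ⌊P⌋₊ + 1
  have hhN : Summable fun i => h (i + N) := (summable_nat_add_iff N).mpr hh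
  have htail : ∀ i, ‖moebiusDivisorTerm k (i + N)‖ ≤ P ^ (1 - (k : ℝ) + δ) * h (i + N) := by
    intro i
    refine abs_moebiusDivisorTerm_le_rpow_mul hP0 ?_ hδk
    have := Nat.lt_floor_add_one P
    push_cast [N]
    linarith [Nat.cast_nonneg (α := ℝ) i]
  rw [sum_coprime_pairs_eq_sum_range k hP0.le, ← tsum_moebiusDivisorTerm hk,
    ← hsum.of_abs.sum_add_tsum_nat_add N, sub_add_cancel_left, abs_neg]
  calc |∑' i, moebiusDivisorTerm k (i + N)|
      ≤ ∑' i, P ^ (1 - (k : ℝ) + δ) * h (i + N) :=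
        tsum_of_norm_bounded (hhN.mul_left _).hasSum htail
    _ = (∑' i, h (i + N)) * P ^ (1 - (k : ℝ) + δ) := by rw [tsum_mul_left, mul_comm]
    _ ≤ (∑' n, h n + 1) * P ^ (1 - (k : ℝ) + ε) := by
        have hle : ∑' i, h (i + N) ≤ ∑' n, h n + 1 := by
          linarith [hh.sum_add_tsum_nat_add N,
            Finset.sum_nonneg fun i (_ : i ∈ Finset.range N) => hh0 i]
        have : δ ≤ ε := min_le_left _ _
        have : 0 ≤ ∑' n, h n := tsum_nonneg hh0
        gcongr
end
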